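/- Consider a FAIM classical channel: let S be a finite nonempty type, Q : S → S → ℝ a row-stochastic matrix that is irreducible and aperiodic with stationary probability vector μ, 𝒴 a finite nonempty type, and W : S → Bool → 𝒴 → ℝ a family of probability mass functions. For N = 2ⁿ, let the joint law of (X₁^N, Y₁^N) on (Fin N → Bool) × (Fin N → 𝒴) be P(x, y) = 2^{−N} · ∑_{s ∈ Fin N → S} μ(s₁) · ∏_{i=1}^{N−1} Q(s_i, s_{i+1}) · ∏_{i=1}^{N} W(s_i)(x_i)(y_i), and let U₁^N = X₁^N · (B_N F^{⊗n}) be the Arıkan polar transform over 𝔽₂. Let 𝓗_{X|Y} = lim_{N→∞} (1/N) H(X₁^N | Y₁^N) denote the base-2 conditional entropy rate. Then fast polarization holds: for every β < 1/2, lim_{N→∞} (1/N) · |{ i : Z(U_i | (U_{<i}, Y₁^N)) < 2^{−N^β} }| = 1 − 𝓗_{X|Y}, where for a Bool-valued random variable A and a finite-valued random variable V, the Bhattacharyya parameter is Z(A | V) = 2 · ∑_v √( P(A = 0, V = v) · P(A = 1, V = v) ). -/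

import Mathlib

open Filter Topology

/-! ### Finite-probability-space Shannon entropy machinery -/

/-- Probability that the random variable `A` takes the value `a`, on a finite
probability space with weight function `μ`. -/
noncomputable def prb {Ω α : Type*} [Fintype Ω] [DecidableEq α]
    (μ : Ω → ℝ) (A : Ω → α) (a : α) : ℝ :=
  ∑ ω, if A ω = a then μ ω else 0

/-- Base-2 Shannon entropy `H(A)`. -/
noncomputable def entH {Ω α : Type*} [Fintype Ω] [Fintype α] [DecidableEq α]
    (μ : Ω → ℝ) (A : Ω → α) : ℝ :=
  -∑ a, prb μ A a * Real.logb 2 (prb μ A a)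

/-- Base-2 conditional Shannon entropy `H(A | B)`. -/
noncomputable def condEnt {Ω α β : Type*} [Fintype Ω] [Fintype α] [Fintype β]
    [DecidableEq α] [DecidableEq β] (μ : Ω → ℝ) (A : Ω → α) (B : Ω → β) : ℝ :=
  -∑ a, ∑ b, prb μ (fun ω => (A ω, B ω)) (a, b) *
      Real.logb 2 (prb μ (fun ω => (A ω, B ω)) (a, b) / prb μ B b)

/-- The Bhattacharyya parameter
`Z(A | V) = 2 ∑_v √(P(A = 0, V = v) · P(A = 1, V = v))`
of a bit `A` given a finite-valued random variable `V`. -/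
noncomputable def bhatta {Ω V : Type*} [Fintype Ω] [Fintype V] [DecidableEq V]
    (μ : Ω → ℝ) (A : Ω → ZMod 2) (B : Ω → V) : ℝ :=
  2 * ∑ v, Real.sqrt (prb μ (fun ω => (A ω, B ω)) (0, v) *
      prb μ (fun ω => (A ω, B ω)) (1, v))

/-! ### The Arıkan polar transform matrix `B_N F^{⊗n}` over `𝔽₂` -/

/-- The `k`-th binary digit of `i`. -/
def bitOf (i k : ℕ) : Fin 2 := ⟨i / 2 ^ k % 2, Nat.mod_lt _ (by norm_num)⟩

/-- Arıkan's kernel `F = [[1,0],[1,1]]`. -/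
def Fmat : Matrix (Fin 2) (Fin 2) (ZMod 2) := !![1, 0; 1, 1]

/-- The polar transform matrix `B_N F^{⊗n}` (`N = 2ⁿ`): the Kronecker power
`F^{⊗n}` with bit-reversed row indices, written entrywise as
`(B_N F^{⊗n})_{i j} = ∏_k F_{bit_{n-1-k}(i), bit_k(j)}`. -/
def polarMatrix (n : ℕ) : Matrix (Fin (2 ^ n)) (Fin (2 ^ n)) (ZMod 2) :=
  Matrix.of fun i j => ∏ k ∈ Finset.range n, Fmat (bitOf i (n - 1 - k)) (bitOf j k)

/-! ### The FAIM classical channel joint law and polarized inputs -/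

/-- The joint law of `(X₁^N, Y₁^N)` (`N = 2ⁿ`) for a FAIM classical channel:
i.i.d. uniform input bits, hidden Markov noise states started in the stationary
distribution `μ`, and outputs emitted by `W`:
`P(x,y) = 2^{-N} ∑_s μ(s₁) ∏ Q(sᵢ,sᵢ₊₁) ∏ W(sᵢ)(xᵢ)(yᵢ)`. -/
noncomputable def faimLaw {S 𝒴 : Type*} [Fintype S]
    (Q : Matrix S S ℝ) (μ : S → ℝ) (W : S → Bool → 𝒴 → ℝ) (n : ℕ) :
    (Fin (2 ^ n) → Bool) × (Fin (2 ^ n) → 𝒴) → ℝ :=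
  fun xy => ((2 : ℝ) ^ (2 ^ n))⁻¹ * ∑ s : Fin (2 ^ n) → S,
      μ (s ⟨0, Nat.two_pow_pos n⟩) *
      (∏ i : Fin (2 ^ n), if h : (i : ℕ) + 1 < 2 ^ n then Q (s i) (s ⟨(i : ℕ) + 1, h⟩) else 1) *
      ∏ i : Fin (2 ^ n), W (s i) (xy.1 i) (xy.2 i)

/-- The polar-transformed input `U = X · (B_N F^{⊗n})` over `𝔽₂`, as a random
variable on `(Fin N → Bool) × (Fin N → 𝒴)`. -/
def polarU {𝒴 : Type*} (n : ℕ)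
    (ω : (Fin (2 ^ n) → Bool) × (Fin (2 ^ n) → 𝒴)) : Fin (2 ^ n) → ZMod 2 :=
  Matrix.vecMul (fun j => if ω.1 j then 1 else 0) (polarMatrix n)

namespace FP

noncomputable def frac (n : ℕ) (P : ℕ → Prop) [DecidablePred P] : ℝ :=
  (((Finset.range (2 ^ n)).filter P).card : ℝ) / 2 ^ n

lemma sum_range_two_mul (M : ℕ) (g : ℕ → ℝ) :
    ∑ j ∈ Finset.range (2 * M), g j = ∑ j ∈ Finset.range M, (g (2 * j) + g (2 * j + 1)) := by
  induction M with
  | zero => simp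
  | succ k ih =>
    rw [show 2 * (k + 1) = 2 * k + 1 + 1 by ring, Finset.sum_range_succ, Finset.sum_range_succ, ih,
      Finset.sum_range_succ]
    ring

lemma sum_range_two_pow_succ (n : ℕ) (g : ℕ → ℝ) :
    ∑ j ∈ Finset.range (2 ^ (n + 1)), g j
      = ∑ j ∈ Finset.range (2 ^ n), (g (2 * j) + g (2 * j + 1)) := by
  rw [pow_succ', sum_range_two_mul]

/-- paths that stay below `η` from level `m` on -/
def Gd (z : ℕ → ℕ → ℝ) (η : ℝ) (m : ℕ) : ℕ → ℕ → Prop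
  | 0, j => z m j < η
  | (k + 1), j => Gd z η m k (j / 2) ∧ z (m + k + 1) j < η

lemma Gd_lt {z : ℕ → ℕ → ℝ} {η : ℝ} {m k j : ℕ} (h : Gd z η m k j) : z (m + k) j < η := by
  cases k with
  | zero => exact h
  | succ k => exact h.2

open Classical in
lemma Gd_sum_le (z : ℕ → ℕ → ℝ) (η : ℝ) (m : ℕ) (φ : ℝ → ℝ) (c : ℝ) (hc : 0 ≤ c)
    (hφ : ∀ k j, Gd z η m (k + 1) j → 0 ≤ φ (z (m + k + 1) j))
    (h : ∀ k j, j < 2 ^ (m + k) → Gd z η m k j →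
      (if z (m + k + 1) (2 * j) < η then φ (z (m + k + 1) (2 * j)) else 0)
      + (if z (m + k + 1) (2 * j + 1) < η then φ (z (m + k + 1) (2 * j + 1)) else 0)
       ≤ c * φ (z (m + k) j)) (k : ℕ) :
    ∑ j ∈ Finset.range (2 ^ (m + k)), (if Gd z η m k j then φ (z (m + k) j) else 0)
      ≤ c ^ k * ∑ j ∈ Finset.range (2 ^ m), (if Gd z η m 0 j then φ (z m j) else 0) := by
  induction k with
  | zero => simp
  | succ k ih =>
    rw [← add_assoc, sum_range_two_pow_succ, pow_succ', mul_assoc]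
    refine le_trans ?_ (mul_le_mul_of_nonneg_left ih hc)
    rw [Finset.mul_sum]
    apply Finset.sum_le_sum
    intro j hj
    have hj' := Finset.mem_range.1 hj
    have e1 : (2 * j) / 2 = j := by omega
    have e2 : (2 * j + 1) / 2 = j := by omega
    by_cases hG : Gd z η m k j
    · have := h k j hj' hG
      simpa [Gd, e1, e2, hG] using this
    · simp [Gd, e1, e2, hG]

open Classical in
lemma Gd_sum_ge (z : ℕ → ℕ → ℝ) (η : ℝ) (m : ℕ) (φ : ℝ → ℝ)
    (h : ∀ k j, j < 2 ^ (m + k) → Gd z η m k j →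
      2 * φ (z (m + k) j) ≤
      (if z (m + k + 1) (2 * j) < η then φ (z (m + k + 1) (2 * j)) else 0)
      + (if z (m + k + 1) (2 * j + 1) < η then φ (z (m + k + 1) (2 * j + 1)) else 0)) (k : ℕ) :
    2 ^ k * ∑ j ∈ Finset.range (2 ^ m), (if Gd z η m 0 j then φ (z m j) else 0) ≤ 
    ∑ j ∈ Finset.range (2 ^ (m + k)), (if Gd z η m k j then φ (z (m + k) j) else 0) := by
  induction k with
  | zero => simp
  | succ k ih =>
    rw [← add_assoc, sum_range_two_pow_succ, pow_succ', mul_assoc]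
    refine le_trans (mul_le_mul_of_nonneg_left ih (by norm_num)) ?_
    rw [Finset.mul_sum]
    apply Finset.sum_le_sum
    intro j hj
    have hj' := Finset.mem_range.1 hj
    have e1 : (2 * j) / 2 = j := by omega
    have e2 : (2 * j + 1) / 2 = j := by omega
    by_cases hG : Gd z η m k j
    · have := h k j hj' hG
      simpa [Gd, e1, e2, hG] using this
    · simp [Gd, e1, e2, hG]

/-- exponent choice -/
lemma exists_s (β : ℝ) (hβ0 : 0 < β) (hβ : β < 1 / 2) :
    ∃ s : ℝ, 0 < s ∧ (2:ℝ) ^ (β * s) * ((1 + 2 ^ (-s)) / 2) < 1 := by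
  have hl : 0 < Real.log 2 := Real.log_pos (by norm_num)
  set γ := 1 / 2 - β with hγ
  have hγ0 : 0 < γ := by linarith
  refine ⟨4 * γ / Real.log 2, by positivity, ?_⟩
  have h1 : (2:ℝ) ^ (β * (4 * γ / Real.log 2)) = Real.exp (4 * γ * β) := by
    rw [Real.rpow_def_of_pos (by norm_num)]; congr 1; field_simp
  have h2 : (2:ℝ) ^ (-(4 * γ / Real.log 2)) = Real.exp (- (4 * γ)) := by
    rw [Real.rpow_def_of_pos (by norm_num)]; congr 1; field_simp
  rw [h1, h2]
  have h3 : Real.exp (4 * γ * β) * ((1 + Real.exp (-(4 * γ))) / 2)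
      = Real.exp (-(4 * γ ^ 2)) * Real.cosh (2 * γ) := by
    rw [Real.cosh_eq, mul_div_assoc', mul_div_assoc', mul_add, mul_add, mul_one, ← Real.exp_add,
      ← Real.exp_add, ← Real.exp_add]
    congr 3 <;> rw [hγ] <;> ring
  rw [h3]
  calc _ ≤ Real.exp (-(4 * γ ^ 2)) * Real.exp ((2 * γ) ^ 2 / 2) :=
        mul_le_mul_of_nonneg_left (Real.cosh_le_exp_half_sq _) (Real.exp_pos _).le
    _ = Real.exp (-(2 * γ ^ 2)) := by rw [← Real.exp_add]; congr 1; ring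
    _ < 1 := by rw [Real.exp_lt_one_iff]; nlinarith

lemma exists_s1 (κ : ℝ) (hκ : 2 ≤ κ) : ∃ s : ℝ, 0 < s ∧ κ ^ s ≤ 3 / 2 := by
  have h1 : 0 < Real.log κ := Real.log_pos (by linarith)
  refine ⟨Real.log (3/2) / Real.log κ, div_pos (Real.log_pos (by norm_num)) h1, ?_⟩
  rw [Real.rpow_def_of_pos (by linarith), mul_div_cancel₀ _ h1.ne', Real.exp_log (by norm_num)]

lemma theta_child {z z' η κ ρ c s : ℝ} (hs : 0 < s) (hz : 0 ≤ z) (hz' : 0 ≤ z') (hη : η < 1)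
    (hρ : 0 < ρ) (hc : 0 < c) (hzη : z < η)
    (hle : 0 < z → z' ≤ Real.exp (c * ρ * Real.log z)) (hz0 : z = 0 → z' = 0) :
    (- Real.log z') ^ (-s) ≤ (c * ρ) ^ (-s) * (- Real.log z) ^ (-s) := by
  rcases hz'.eq_or_lt with h | h
  · rw [← h]; simp only [Real.log_zero, neg_zero]
    rw [Real.zero_rpow (by linarith)]
    rcases hz.eq_or_lt with h2 | h2
    · rw [← h2]; simp [Real.zero_rpow (show -s ≠ 0 by linarith)]
    · have := Real.log_neg h2 (by linarith)
      have : 0 < - Real.log z := by linarith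
      positivity
  · have hzp : 0 < z := by
      rcases hz.eq_or_lt with h2 | h2
      · exact absurd (hz0 h2.symm) h.ne'
      · exact h2
    have hL : 0 < - Real.log z := by have := Real.log_neg hzp (by linarith); linarith
    rw [← Real.mul_rpow (by positivity) hL.le]
    apply Real.rpow_le_rpow_of_nonpos (by positivity) _ (by linarith)
    have := (Real.log_le_iff_le_exp h).2 (hle hzp)
    linarith

open Classical in
theorem fast_abstract (z : ℕ → ℕ → ℝ) (hz0 : ∀ n j, 0 ≤ z n j) (κ : ℝ) (hκ : 2 ≤ κ)
    (hrec : ∀ n j, j < 2 ^ n →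
      (z (n + 1) (2 * j) ≤ κ * z n j ∧ z (n + 1) (2 * j + 1) ≤ κ * z n j ^ 2) ∨
      (z (n + 1) (2 * j + 1) ≤ κ * z n j ∧ z (n + 1) (2 * j) ≤ κ * z n j ^ 2))
    (β : ℝ) (hβ0 : 0 < β) (hβ : β < 1 / 2) (ε : ℝ) (hε : 0 < ε) (hε1 : ε < 1) :
    ∃ η > 0, ∀ m, ∀ᶠ n in atTop,
      (1 - ε) * frac m (fun j => z m j ≤ η) - ε ≤
        frac n (fun j => z n j < (2:ℝ) ^ (-(((2 ^ n : ℕ) : ℝ) ^ β))) := by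
  obtain ⟨s, hs, hF⟩ := exists_s β hβ0 hβ
  obtain ⟨s1, hs1, hκs⟩ := exists_s1 κ hκ
  set F := (2:ℝ) ^ (β * s) * ((1 + 2 ^ (-s)) / 2) with hFdef
  have hF0 : 0 < F := by positivity
  set ρ := F ^ (1 / (2 * s)) with hρdef
  have hρ0 : 0 < ρ := by positivity
  have hρ1 : ρ < 1 := Real.rpow_lt_one hF0.le hF (by positivity)
  have hρs : ρ ^ (-s) = (Real.sqrt F)⁻¹ := by
    rw [hρdef, ← Real.rpow_mul hF0.le, Real.sqrt_eq_rpow, ← Real.rpow_neg hF0.le]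
    congr 1; field_simp
  have hlκ : 0 < Real.log κ := Real.log_pos (by linarith)
  have hκ0 : 0 < κ := by linarith
  -- choose η
  obtain ⟨η, hη0, hη1, hηa, hηb⟩ : ∃ η : ℝ, 0 < η ∧ η < 1 ∧ η ^ s1 ≤ 1 / 3 ∧
      Real.log κ ≤ (1 - ρ) * (- Real.log η) := by
    refine ⟨min ((1/3 : ℝ) ^ (1 / s1)) (Real.exp (- (Real.log κ / (1 - ρ)))), by positivity, ?_, ?_, ?_⟩
    · apply lt_of_le_of_lt (min_le_left _ _)
      exact Real.rpow_lt_one (by norm_num) (by norm_num) (by positivity)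
    · calc _ ≤ ((1/3 : ℝ) ^ (1 / s1)) ^ s1 :=
            Real.rpow_le_rpow (by positivity) (min_le_left _ _) hs1.le
        _ = 1 / 3 := by rw [← Real.rpow_mul (by norm_num)]; field_simp; simp
    · have h1 : Real.log (min ((1/3 : ℝ) ^ (1 / s1)) (Real.exp (- (Real.log κ / (1 - ρ))))) ≤
          - (Real.log κ / (1 - ρ)) := by
        rw [Real.log_le_iff_le_exp (by positivity)]; exact min_le_right _ _
      have h2 : 0 < 1 - ρ := by linarith
      calc Real.log κ = (1 - ρ) * (Real.log κ / (1 - ρ)) := by field_simp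
        _ ≤ _ := mul_le_mul_of_nonneg_left (by linarith) h2.le
  refine ⟨η * ε ^ (1 / s1), by positivity, fun m => ?_⟩
  set θ : ℝ → ℝ := fun z => (- Real.log z) ^ (-s) with hθ
  set w : ℝ → ℝ := fun z => 1 - (z / η) ^ s1 with hw
  have hθ0 : ∀ x, 0 ≤ x → x < η → 0 ≤ θ x := by
    intro x hx hx'
    apply Real.rpow_nonneg
    have := Real.log_nonpos hx (by linarith)
    linarith
  have hw_nonpos : ∀ x, ¬ x < η → w x ≤ 0 := by
    intro x hx
    have : 1 ≤ (x / η) ^ s1 := Real.one_le_rpow (by rw [le_div_iff₀ hη0]; linarith) hs1.le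
    simp only [hw]; linarith
  have hif : ∀ x, w x ≤ if x < η then w x else 0 := by
    intro x; split_ifs with h
    · exact le_rfl
    · exact hw_nonpos x h
  -- growth claims
  have hL : ∀ x, 0 < x → x < η → Real.log κ ≤ (1 - ρ) * (- Real.log x) := by
    intro x hx hx'
    have := Real.log_lt_log hx hx'
    refine hηb.trans (mul_le_mul_of_nonneg_left (by linarith) (by linarith))
  have hA : ∀ x x', 0 ≤ x → 0 ≤ x' → x < η → x' ≤ κ * x → θ x' ≤ ρ ^ (-s) * θ x := by
    intro x x' hx hx' hxη hle
    have := theta_child (z := x) (z' := x') (η := η) (κ := κ) (ρ := ρ) (c := 1) hs hx hx' hη1 hρ0 one_pos hxη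
      (fun hx0 => by
        refine hle.trans ?_
        have h1 := hL x hx0 hxη
        calc κ * x = Real.exp (Real.log κ + Real.log x) := by
              rw [Real.exp_add, Real.exp_log hκ0, Real.exp_log hx0]
          _ ≤ _ := Real.exp_le_exp.2 (by linarith))
      (fun h => by rw [h] at hle; linarith)
    rwa [one_mul] at this
  have hB : ∀ x x', 0 ≤ x → 0 ≤ x' → x < η → x' ≤ κ * x ^ 2 → θ x' ≤ (2 ^ (-s) * ρ ^ (-s)) * θ x := by
    intro x x' hx hx' hxη hle
    have := theta_child (z := x) (z' := x') (η := η) (κ := κ) (ρ := ρ) (c := 2) hs hx hx' hη1 hρ0 two_pos hxη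
      (fun hx0 => by
        refine hle.trans ?_
        have h1 := hL x hx0 hxη
        have h2 := Real.log_neg hx0 (by linarith)
        calc κ * x ^ 2 = Real.exp (Real.log κ + 2 * Real.log x) := by
              rw [Real.exp_add, Real.exp_log hκ0, two_mul, Real.exp_add, Real.exp_log hx0]; ring
          _ ≤ _ := Real.exp_le_exp.2 (by nlinarith))
      (fun h => by rw [h] at hle; nlinarith)
    rwa [Real.mul_rpow (by norm_num) hρ0.le] at this
  have hC : ∀ x x', 0 ≤ x → 0 ≤ x' → x' ≤ κ * x → (x' / η) ^ s1 ≤ 3 / 2 * (x / η) ^ s1 := by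
    intro x x' hx hx' hle
    calc (x' / η) ^ s1 ≤ (κ * (x / η)) ^ s1 := by
          apply Real.rpow_le_rpow (by positivity) _ hs1.le
          rw [mul_div_assoc']; gcongr
      _ = κ ^ s1 * (x / η) ^ s1 := Real.mul_rpow (by positivity) (by positivity)
      _ ≤ _ := by gcongr
  have hD : ∀ x x', 0 ≤ x → 0 ≤ x' → x < η → x' ≤ κ * x ^ 2 →
      (x' / η) ^ s1 ≤ 1 / 2 * (x / η) ^ s1 := by
    intro x x' hx hx' hxη hle
    calc (x' / η) ^ s1 ≤ (κ * (η * (x / η))) ^ s1 := by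
          apply Real.rpow_le_rpow (by positivity) _ hs1.le
          rw [div_le_iff₀ hη0]
          calc x' ≤ κ * (x * x) := by rw [← sq]; exact hle
            _ ≤ κ * (x * η) := by gcongr
            _ = _ := by field_simp
      _ = κ ^ s1 * (η ^ s1 * (x / η) ^ s1) := by
          rw [Real.mul_rpow (by positivity) (by positivity), Real.mul_rpow (by positivity) (by positivity)]
      _ ≤ 3 / 2 * (1 / 3 * (x / η) ^ s1) := by gcongr
      _ = _ := by ring
  have hΨ := Gd_sum_ge z η m w (by
    intro k j hj hG
    have hlt := Gd_lt hG
    refine le_trans ?_ (add_le_add (hif _) (hif _))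
    simp only [hw]
    rcases hrec (m + k) j hj with h | h
    · have a := hC _ _ (hz0 _ _) (hz0 _ _) h.1
      have b := hD _ _ (hz0 _ _) (hz0 _ _) hlt h.2
      linarith
    · have a := hC _ _ (hz0 _ _) (hz0 _ _) h.1
      have b := hD _ _ (hz0 _ _) (hz0 _ _) hlt h.2
      linarith)
  have hifθ : ∀ x, 0 ≤ θ x → (if x < η then θ x else 0) ≤ θ x := by
    intro x hx; split_ifs <;> simp [hx]
  have hΘ := Gd_sum_le z η m θ (ρ ^ (-s) * (1 + 2 ^ (-s))) (by positivity)
    (fun k j hG => hθ0 _ (hz0 _ _) hG.2) (by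
    intro k j hj hG
    have hlt := Gd_lt hG
    have hb1 : ∀ x' c, 0 ≤ x' → 0 ≤ c → θ x' ≤ c * θ (z (m + k) j) →
        (if x' < η then θ x' else 0) ≤ c * θ (z (m + k) j) := by
      intro x' c hx' hc h
      split_ifs
      · exact h
      · exact mul_nonneg hc (hθ0 _ (hz0 _ _) hlt)
    rcases hrec (m + k) j hj with h | h
    · have a := hb1 _ _ (hz0 _ _) (by positivity) (hA _ _ (hz0 _ _) (hz0 _ _) hlt h.1)
      have b := hb1 _ _ (hz0 _ _) (by positivity) (hB _ _ (hz0 _ _) (hz0 _ _) hlt h.2)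
      linarith
    · have a := hb1 _ _ (hz0 _ _) (by positivity) (hA _ _ (hz0 _ _) (hz0 _ _) hlt h.1)
      have b := hb1 _ _ (hz0 _ _) (by positivity) (hB _ _ (hz0 _ _) (hz0 _ _) hlt h.2)
      linarith)
  set Θ0 := ∑ j ∈ Finset.range (2 ^ m), (if Gd z η m 0 j then θ (z m j) else 0) with hΘ0
  set Ψ0 := ∑ j ∈ Finset.range (2 ^ m), (if Gd z η m 0 j then w (z m j) else 0) with hΨ0
  -- lower bound for Ψ0
  have hΨ0' : (1 - ε) * (((Finset.range (2 ^ m)).filter (fun j => z m j ≤ η * ε ^ (1 / s1))).card : ℝ) ≤ Ψ0 := by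
    rw [Finset.card_filter, Nat.cast_sum, Finset.mul_sum]
    apply Finset.sum_le_sum
    intro j _
    have hεs : (ε ^ (1 / s1)) ^ s1 = ε := by
      rw [← Real.rpow_mul hε.le]; field_simp; simp
    have hεlt : ε ^ (1 / s1) < 1 := Real.rpow_lt_one hε.le hε1 (by positivity)
    have hpos : z m j < η → 0 ≤ w (z m j) := by
      intro h
      have : (z m j / η) ^ s1 ≤ 1 := Real.rpow_le_one (div_nonneg (hz0 _ _) hη0.le)
        (by rw [div_le_one hη0]; exact h.le) hs1.le
      simp only [hw]; linarith
    by_cases h : z m j ≤ η * ε ^ (1 / s1)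
    · have h2 : z m j < η := by nlinarith
      have h3 : (z m j / η) ^ s1 ≤ ε := by
        rw [← hεs]
        apply Real.rpow_le_rpow (div_nonneg (hz0 _ _) hη0.le) _ hs1.le
        rw [div_le_iff₀ hη0]; linarith
      simp only [h, if_true, Gd, h2, hw]
      push_cast; linarith
    · rw [if_neg h]
      by_cases h2 : z m j < η
      · simpa [Gd, h2] using hpos h2
      · simp [Gd, h2]
  have hlim : Tendsto (fun k : ℕ => (2:ℝ) ^ ((m:ℝ) * β * s) * (Real.sqrt F) ^ k * (Θ0 / 2 ^ m)) atTop (𝓝 0) := by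
    have : Tendsto (fun k : ℕ => (Real.sqrt F) ^ k) atTop (𝓝 0) :=
      tendsto_pow_atTop_nhds_zero_of_lt_one (Real.sqrt_nonneg _) (by
        rw [Real.sqrt_lt' one_pos]; simpa using hF)
    simpa using (this.const_mul ((2:ℝ) ^ ((m:ℝ) * β * s))).mul_const (Θ0 / 2 ^ m)
  have hev := hlim.eventually (gt_mem_nhds hε)
  have hkey : ∀ᶠ k in atTop, (1 - ε) * frac m (fun j => z m j ≤ η * ε ^ (1 / s1)) - ε ≤
        frac (m + k) (fun j => z (m + k) j < (2:ℝ) ^ (-(((2 ^ (m + k) : ℕ) : ℝ) ^ β))) := by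
    filter_upwards [hev] with k hk
    set thr := (2:ℝ) ^ (-(((2 ^ (m + k) : ℕ) : ℝ) ^ β)) with hthr
    set V := ((2 ^ (m + k) : ℕ) : ℝ) ^ β with hV
    have hV0 : 0 < V := by positivity
    have hlow : 2 ^ k * Ψ0 - V ^ s * ((ρ ^ (-s) * (1 + 2 ^ (-s))) ^ k * Θ0) ≤
        (((Finset.range (2 ^ (m + k))).filter (fun j => z (m + k) j < thr)).card : ℝ) := by
      have h1 : 2 ^ k * Ψ0 - V ^ s * ((ρ ^ (-s) * (1 + 2 ^ (-s))) ^ k * Θ0) ≤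
        (∑ j ∈ Finset.range (2 ^ (m + k)), (if Gd z η m k j then w (z (m + k) j) else 0)) -
        V ^ s * ∑ j ∈ Finset.range (2 ^ (m + k)), (if Gd z η m k j then θ (z (m + k) j) else 0) := by
        have := mul_le_mul_of_nonneg_left (hΘ k) (show 0 ≤ V ^ s by positivity)
        linarith [hΨ k]
      refine h1.trans ?_
      rw [Finset.card_filter, Nat.cast_sum, Finset.mul_sum, ← Finset.sum_sub_distrib]
      apply Finset.sum_le_sum
      intro j _
      by_cases hG : Gd z η m k j
      · simp only [hG, if_true]
        have hlt := Gd_lt hG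
        have hθn := hθ0 _ (hz0 (m + k) j) hlt
        have hw1 : w (z (m + k) j) ≤ 1 := by
          have : 0 ≤ (z (m + k) j / η) ^ s1 := Real.rpow_nonneg (div_nonneg (hz0 _ _) hη0.le) _
          simp only [hw]; linarith
        split_ifs with h
        · have : 0 ≤ V ^ s * θ (z (m + k) j) := by positivity
          push_cast; linarith
        · push_cast
          suffices 1 ≤ V ^ s * θ (z (m + k) j) by linarith
          have hzp : 0 < z (m + k) j := lt_of_lt_of_le (by positivity) (not_lt.1 h)
          have hlogz : Real.log thr ≤ Real.log (z (m + k) j) :=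
            Real.log_le_log (by positivity) (not_lt.1 h)
          have hlt0 := Real.log_neg hzp (by linarith)
          rw [hthr, Real.log_rpow (by norm_num)] at hlogz
          have hl2 : Real.log 2 ≤ 1 := by have := Real.log_two_lt_d9; linarith
          have : V ^ (-s) ≤ θ (z (m + k) j) := by
            apply Real.rpow_le_rpow_of_nonpos (by linarith) _ (by linarith)
            nlinarith
          calc (1:ℝ) = V ^ s * V ^ (-s) := by rw [← Real.rpow_add hV0]; simp
            _ ≤ _ := mul_le_mul_of_nonneg_left this (by positivity)
      · simp only [hG, if_false]; split_ifs <;> simp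
    unfold frac
    rw [le_div_iff₀ (by positivity)]
    refine le_trans ?_ hlow
    have hVs : V ^ s = (2:ℝ) ^ ((m:ℝ) * β * s) * ((2:ℝ) ^ (β * s)) ^ k := by
      have e1 : ((2:ℝ) ^ (β * s)) ^ k = (2:ℝ) ^ (β * s * k) := by
        rw [Real.rpow_mul (by norm_num) (β * s) k, Real.rpow_natCast]
      have e2 : ((2 ^ (m + k) : ℕ) : ℝ) = (2:ℝ) ^ ((m + k : ℕ) : ℝ) := by
        rw [Real.rpow_natCast]; push_cast; rfl
      rw [hV, e1, e2, ← Real.rpow_mul (by positivity), ← Real.rpow_mul (by positivity),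
        ← Real.rpow_add (by norm_num)]
      congr 1; push_cast; ring
    have hprod : (2:ℝ) ^ (β * s) * (ρ ^ (-s) * (1 + 2 ^ (-s))) = 2 * Real.sqrt F := by
      have : (2:ℝ) ^ (β * s) * (1 + 2 ^ (-s)) = 2 * F := by rw [hFdef]; ring
      rw [mul_left_comm, this, hρs]
      have h3 : Real.sqrt F ≠ 0 := (Real.sqrt_pos.2 hF0).ne'
      field_simp
      rw [Real.sq_sqrt hF0.le]
    have e : V ^ s * ((ρ ^ (-s) * (1 + 2 ^ (-s))) ^ k * Θ0)
        = 2 ^ (m + k) * ((2:ℝ) ^ ((m:ℝ) * β * s) * (Real.sqrt F) ^ k * (Θ0 / 2 ^ m)) := by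
      rw [hVs]
      calc _ = (2:ℝ) ^ ((m:ℝ) * β * s) * (((2:ℝ) ^ (β * s) * (ρ ^ (-s) * (1 + 2 ^ (-s)))) ^ k) * Θ0 := by
            rw [mul_pow ((2:ℝ) ^ (β * s)) _ k]; ring
        _ = _ := by rw [hprod, mul_pow, pow_add]; field_simp
    rw [e]
    have h5 : (0:ℝ) < 2 ^ (m + k) := by positivity
    have h6 := mul_le_mul_of_nonneg_left hΨ0' (show (0:ℝ) ≤ 2 ^ k by positivity)
    have h7 : ((1 - ε) * ((((Finset.range (2 ^ m)).filter (fun j => z m j ≤ η * ε ^ (1 / s1))).card : ℝ) / 2 ^ m)) * 2 ^ (m + k)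
        = 2 ^ k * ((1 - ε) * (((Finset.range (2 ^ m)).filter (fun j => z m j ≤ η * ε ^ (1 / s1))).card : ℝ)) := by
      rw [pow_add]; field_simp
    rw [sub_mul, h7]
    have := mul_le_mul_of_nonneg_left hk.le h5.le
    linarith
  rw [eventually_atTop] at hkey ⊢
  obtain ⟨k0, hk0⟩ := hkey
  refine ⟨m + k0, fun n hn => ?_⟩
  obtain ⟨k, rfl⟩ := Nat.exists_eq_add_of_le (show m ≤ n by omega)
  exact hk0 k (by omega)

end FP

namespace FP

noncomputable def phi (a b : ℝ) : ℝ :=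
  Real.negMulLog a + Real.negMulLog b - Real.negMulLog (a + b)

noncomputable def tau (a b : ℝ) : ℝ := (a - b) ^ 2 / (a + b)

lemma phi_zero : phi 0 0 = 0 := by simp [phi]

lemma tau_zero : tau 0 0 = 0 := by simp [tau]

lemma phi_smul (c a b : ℝ) : phi (c * a) (c * b) = c * phi a b := by
  unfold phi
  rw [← mul_add, Real.negMulLog_mul, Real.negMulLog_mul, Real.negMulLog_mul]
  ring

lemma tau_smul (c a b : ℝ) : tau (c * a) (c * b) = c * tau a b := by
  unfold tau
  rw [← mul_sub, ← mul_add]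
  by_cases hc : c = 0
  · simp [hc]
  by_cases h : a + b = 0
  · simp [h]
  field_simp

lemma phi_bin {p : ℝ} : phi p (1 - p) = Real.binEntropy p := by
  rw [Real.binEntropy_eq_negMulLog_add_negMulLog_one_sub]
  simp [phi]

/-- normal form -/
lemma norm_pair {a b : ℝ} (ha : 0 ≤ a) (hb : 0 ≤ b) :
    ∃ c p : ℝ, 0 ≤ c ∧ 0 ≤ p ∧ p ≤ 1 ∧ a = c * p ∧ b = c * (1 - p) := by
  by_cases h : a + b = 0
  · exact ⟨0, 0, le_rfl, le_rfl, zero_le_one, by linarith, by linarith⟩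
  · have h' : 0 < a + b := lt_of_le_of_ne (by positivity) (Ne.symm h)
    refine ⟨a + b, a / (a + b), h'.le, by positivity, ?_, ?_, ?_⟩
    · rw [div_le_one h']; linarith
    · field_simp
    · field_simp; ring

lemma tau_norm (p : ℝ) : tau p (1 - p) = (1 - 2 * p) ^ 2 := by
  unfold tau; rw [show p + (1 - p) = 1 by ring]; ring

lemma phi_nonneg {a b : ℝ} (ha : 0 ≤ a) (hb : 0 ≤ b) : 0 ≤ phi a b := by
  obtain ⟨c, p, hc, hp, hp1, rfl, rfl⟩ := norm_pair ha hb
  rw [phi_smul, phi_bin]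
  exact mul_nonneg hc (Real.binEntropy_nonneg hp hp1)

lemma tau_nonneg {a b : ℝ} (ha : 0 ≤ a) (hb : 0 ≤ b) : 0 ≤ tau a b := by
  unfold tau; positivity

lemma tau_le_abs {a b : ℝ} (ha : 0 ≤ a) (hb : 0 ≤ b) : tau a b ≤ |a - b| := by
  unfold tau
  by_cases h : a + b = 0
  · simp [h]
  have h' : 0 < a + b := lt_of_le_of_ne (by positivity) (Ne.symm h)
  rw [div_le_iff₀ h', ← sq_abs, sq]
  apply mul_le_mul_of_nonneg_left _ (abs_nonneg _)
  rw [abs_le]; constructor <;> linarith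

lemma tau_le_add {a b : ℝ} (ha : 0 ≤ a) (hb : 0 ≤ b) : tau a b ≤ a + b :=
  (tau_le_abs ha hb).trans (by rw [abs_le]; constructor <;> linarith)

lemma phi_le_log {a b : ℝ} (ha : 0 ≤ a) (hb : 0 ≤ b) : phi a b ≤ Real.log 2 * (a + b) := by
  obtain ⟨c, p, hc, hp, hp1, rfl, rfl⟩ := norm_pair ha hb
  rw [phi_smul, phi_bin]
  calc c * Real.binEntropy p ≤ c * Real.log 2 := mul_le_mul_of_nonneg_left Real.binEntropy_le_log_two hc
    _ = _ := by ring

lemma neg_mul_log_le_sqrt {p : ℝ} (hp : 0 ≤ p) : Real.negMulLog p ≤ 2 * (Real.sqrt p - p) := by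
  rcases hp.eq_or_lt with h | h
  · simp [← h]
  · have hs := Real.sqrt_pos.2 h
    have h1 := Real.log_le_sub_one_of_pos (inv_pos.2 hs)
    rw [Real.log_inv, Real.log_sqrt h.le] at h1
    have h2 : p * (Real.sqrt p)⁻¹ = Real.sqrt p := by
      field_simp; rw [Real.sq_sqrt h.le]
    unfold Real.negMulLog
    nlinarith

lemma phi_le_sqrt {a b : ℝ} (ha : 0 ≤ a) (hb : 0 ≤ b) : phi a b ≤ 2 * Real.sqrt (a * b) := by
  obtain ⟨c, p, hc, hp, hp1, rfl, rfl⟩ := norm_pair ha hb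
  rw [phi_smul, phi_bin, Real.binEntropy_eq_negMulLog_add_negMulLog_one_sub,
    show c * p * (c * (1 - p)) = c ^ 2 * (p * (1 - p)) by ring, Real.sqrt_mul (by positivity),
    Real.sqrt_sq hc]
  have h1 := neg_mul_log_le_sqrt hp
  have h2 := neg_mul_log_le_sqrt (show 0 ≤ 1 - p by linarith)
  rw [Real.sqrt_mul hp]
  have e1 := Real.sq_sqrt hp
  have e2 := Real.sq_sqrt (show 0 ≤ 1 - p by linarith)
  set x := Real.sqrt p
  set y := Real.sqrt (1 - p)
  have hx : 0 ≤ x := Real.sqrt_nonneg _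
  have hy : 0 ≤ y := Real.sqrt_nonneg _
  have : x + y - 1 ≤ x * y := by nlinarith [mul_nonneg hx hy]
  nlinarith

lemma phi_ge {a b : ℝ} (ha : 0 ≤ a) (hb : 0 ≤ b) : (a + b) - tau a b ≤ 2 * phi a b := by
  obtain ⟨c, p, hc, hp, hp1, rfl, rfl⟩ := norm_pair ha hb
  rw [phi_smul, tau_smul, phi_bin, tau_norm, Real.binEntropy_eq_negMulLog_add_negMulLog_one_sub]
  have key : ∀ x : ℝ, 0 ≤ x → x * (1 - x) ≤ Real.negMulLog x := by
    intro x hx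
    rcases hx.eq_or_lt with h | h
    · simp [← h]
    · have := Real.log_le_sub_one_of_pos h
      unfold Real.negMulLog; nlinarith
  have h1 := key p hp
  have h2 := key (1 - p) (by linarith)
  nlinarith

lemma log_two_sub_phi {a b : ℝ} (ha : 0 ≤ a) (hb : 0 ≤ b) :
    Real.log 2 * (a + b) - phi a b ≤ tau a b := by
  obtain ⟨c, p, hc, hp, hp1, rfl, rfl⟩ := norm_pair ha hb
  rw [phi_smul, tau_smul, phi_bin, tau_norm, Real.binEntropy_eq_negMulLog_add_negMulLog_one_sub]
  have key : ∀ x : ℝ, 0 ≤ x → x * Real.log 2 - Real.negMulLog x ≤ x * (2 * x - 1) := by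
    intro x hx
    rcases hx.eq_or_lt with h | h
    · simp [← h]
    · have := Real.log_le_sub_one_of_pos (show 0 < 2 * x by linarith)
      rw [Real.log_mul (by norm_num) h.ne'] at this
      unfold Real.negMulLog; nlinarith
  have h1 := key p hp
  have h2 := key (1 - p) (by linarith)
  nlinarith

lemma concave_k : ConcaveOn ℝ (Set.Icc (0:ℝ) 1) (fun p => Real.binEntropy p + (1 - 2 * p) ^ 2 / 2) := by
  apply concaveOn_of_hasDerivWithinAt2_nonpos (convex_Icc 0 1)
    (f' := fun p => Real.log (1 - p) - Real.log p - 2 * (1 - 2 * p))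
    (f'' := fun p => - (1 - p)⁻¹ - p⁻¹ + 4)
  · exact (Real.binEntropy_continuous.add (by fun_prop)).continuousOn
  · intro x hx
    rw [interior_Icc] at hx
    apply HasDerivAt.hasDerivWithinAt
    have h1 := Real.hasDerivAt_binEntropy (p := x) hx.1.ne' hx.2.ne
    have h2 : HasDerivAt (fun p : ℝ => (1 - 2 * p) ^ 2 / 2) (- (2 * (1 - 2 * x))) x := by
      have := ((((hasDerivAt_id' x).const_mul 2).const_sub 1).fun_pow 2).div_const 2
      refine this.congr_deriv ?_
      push_cast; ring
    exact (h1.fun_add h2).congr_deriv (by ring)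
  · intro x hx
    rw [interior_Icc] at hx
    apply HasDerivAt.hasDerivWithinAt
    have h1 : HasDerivAt (fun p : ℝ => Real.log (1 - p)) (- (1 - x)⁻¹) x := by
      have := ((hasDerivAt_id' x).const_sub 1).log (by linarith [hx.2])
      exact this.congr_deriv (by rw [neg_div, one_div])
    have h2 := Real.hasDerivAt_log hx.1.ne'
    have h3 : HasDerivAt (fun p : ℝ => 2 * (1 - 2 * p)) (-4) x := by
      have := (((hasDerivAt_id' x).const_mul 2).const_sub 1).const_mul 2
      exact this.congr_deriv (by norm_num)
    exact ((h1.fun_sub h2).fun_sub h3).congr_deriv (by ring)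
  · intro x hx
    rw [interior_Icc] at hx
    have h1 : 0 < x := hx.1
    have h2 : 0 < 1 - x := by linarith [hx.2]
    have : (1 - x)⁻¹ + x⁻¹ = 1 / (x * (1 - x)) := by field_simp; ring
    have h4 : 4 ≤ 1 / (x * (1 - x)) := by
      rw [le_div_iff₀ (by positivity)]; nlinarith [sq_nonneg (1 - 2 * x)]
    linarith

lemma phi_gain {a0 a1 b0 b1 : ℝ} (ha0 : 0 ≤ a0) (ha1 : 0 ≤ a1) (hb0 : 0 ≤ b0) (hb1 : 0 ≤ b1) :
    (b0 + b1) * phi a0 a1 + tau a0 a1 * ((b0 + b1) - tau b0 b1) / 2 ≤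
      phi (a0 * b0 + a1 * b1) (a1 * b0 + a0 * b1) := by
  obtain ⟨c, p, hc, hp, hp1, rfl, rfl⟩ := norm_pair ha0 ha1
  obtain ⟨d, q, hd, hq, hq1, rfl, rfl⟩ := norm_pair hb0 hb1
  have e1 : c * p * (d * q) + c * (1 - p) * (d * (1 - q)) = (c * d) * (q * p + (1 - q) * (1 - p)) := by ring
  have e2 : c * (1 - p) * (d * q) + c * p * (d * (1 - q)) = (c * d) * (1 - (q * p + (1 - q) * (1 - p))) := by ring
  rw [e1, e2, phi_smul, phi_smul, phi_bin, phi_bin, tau_smul, tau_smul, tau_norm, tau_norm]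
  have h := concave_k.2 (x := p) (y := 1 - p) ⟨hp, hp1⟩ ⟨by linarith, by linarith⟩ hq
    (show 0 ≤ 1 - q by linarith) (by ring)
  simp only [smul_eq_mul, Real.binEntropy_one_sub] at h
  have : Real.binEntropy p + (1 - 2 * p) ^ 2 * (1 - (1 - 2 * q) ^ 2) / 2 ≤
      Real.binEntropy (q * p + (1 - q) * (1 - p)) := by nlinarith
  have h2 := mul_le_mul_of_nonneg_left this (mul_nonneg hc hd)
  nlinarith

/-- superadditivity -/
noncomputable def ent {ι : Type*} [Fintype ι] (c : ι → ℝ) : ℝ :=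
  ∑ i, Real.negMulLog (c i) - Real.negMulLog (∑ i, c i)

lemma logsum_aux {u c X C : ℝ} (hu : 0 ≤ u) (huc : u ≤ c) (hX : 0 < X) (hC : 0 < C) :
    Real.negMulLog u + u * Real.log c ≤ u * (Real.log C - Real.log X) + c * X / C - u := by
  rcases hu.eq_or_lt with h | h
  · rw [← h] at huc ⊢; simp; positivity
  · have hc : 0 < c := by linarith
    have h1 := Real.log_le_sub_one_of_pos (show 0 < c * X / (u * C) by positivity)
    rw [Real.log_div (by positivity) (by positivity), Real.log_mul (by positivity) (by positivity),
      Real.log_mul (by positivity) (by positivity)] at h1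
    have h2 := mul_le_mul_of_nonneg_left h1 hu
    have h3 : u * (c * X / (u * C) - 1) = c * X / C - u := by field_simp
    rw [h3] at h2
    unfold Real.negMulLog
    linarith

lemma ent_superadd {ι κ : Type*} [Fintype ι] [Fintype κ] (c : κ → ι → ℝ) (hc : ∀ t i, 0 ≤ c t i) :
    ∑ t, ent (c t) ≤ ent (fun i => ∑ t, c t i) := by
  set C := ∑ i, ∑ t, c t i with hCdef
  have hC0 : 0 ≤ C := Finset.sum_nonneg fun i _ => Finset.sum_nonneg fun t _ => hc t i
  have hle : ∀ t i, c t i ≤ ∑ i, c t i := fun t i =>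
    Finset.single_le_sum (f := fun i => c t i) (fun i _ => hc t i) (Finset.mem_univ i)
  have e1 : ∀ t, ent (c t) = ∑ i, (Real.negMulLog (c t i) + c t i * Real.log (∑ i, c t i)) := by
    intro t
    rw [Finset.sum_add_distrib, ← Finset.sum_mul]; unfold ent Real.negMulLog; ring
  have e2 : ent (fun i => ∑ t, c t i) = ∑ i, (Real.negMulLog (∑ t, c t i) + (∑ t, c t i) * Real.log C) := by
    rw [Finset.sum_add_distrib, ← Finset.sum_mul]; unfold ent Real.negMulLog; rw [← hCdef]; ring
  rw [e2, Finset.sum_congr rfl (fun t _ => e1 t), Finset.sum_comm]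
  apply Finset.sum_le_sum
  intro i _
  set X := ∑ t, c t i with hX
  have hX0 : 0 ≤ X := Finset.sum_nonneg fun t _ => hc t i
  rcases hX0.eq_or_lt with h | h
  · have : ∀ t, c t i = 0 := by
      intro t
      have := (Finset.sum_eq_zero_iff_of_nonneg (fun t _ => hc t i)).1 (hX.symm.trans h.symm)
      exact this t (Finset.mem_univ _)
    rw [← h]; simp [this]
  · have hXC : X ≤ C := Finset.single_le_sum (f := fun i => ∑ t, c t i)
      (fun i _ => Finset.sum_nonneg fun t _ => hc t i) (Finset.mem_univ i)
    have hCp : 0 < C := by linarith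
    calc _ ≤ ∑ t, (c t i * (Real.log C - Real.log X) + (∑ i, c t i) * X / C - c t i) :=
          Finset.sum_le_sum fun t _ => logsum_aux (hc t i) (hle t i) h hCp
      _ = X * (Real.log C - Real.log X) + (∑ t, ∑ i, c t i) * X / C - X := by
          rw [Finset.sum_sub_distrib, Finset.sum_add_distrib, ← Finset.sum_mul, ← Finset.sum_div,
            ← Finset.sum_mul]
      _ = _ := by
          rw [Finset.sum_comm, ← hCdef]
          unfold Real.negMulLog
          field_simp; ring

lemma ent_two (c : Fin 2 → ℝ) : ent c = phi (c 0) (c 1) := by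
  simp [ent, phi, Fin.sum_univ_two]

lemma phi_superadd {κ : Type*} [Fintype κ] (a b : κ → ℝ) (ha : ∀ t, 0 ≤ a t) (hb : ∀ t, 0 ≤ b t) :
    ∑ t, phi (a t) (b t) ≤ phi (∑ t, a t) (∑ t, b t) := by
  have := ent_superadd (ι := Fin 2) (fun t => ![a t, b t]) (by
    intro t i; fin_cases i <;> simp [ha, hb])
  simpa [ent_two] using this

/-- four-point entropy -/
noncomputable def ent4 (a b c d : ℝ) : ℝ :=
  Real.negMulLog a + Real.negMulLog b + Real.negMulLog c + Real.negMulLog d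
    - Real.negMulLog (a + b + c + d)

lemma ent4_superadd {κ : Type*} [Fintype κ] (a b c d : κ → ℝ) (ha : ∀ t, 0 ≤ a t) (hb : ∀ t, 0 ≤ b t)
    (hc : ∀ t, 0 ≤ c t) (hd : ∀ t, 0 ≤ d t) :
    ∑ t, ent4 (a t) (b t) (c t) (d t) ≤ ent4 (∑ t, a t) (∑ t, b t) (∑ t, c t) (∑ t, d t) := by
  have := ent_superadd (ι := Fin 4) (fun t => ![a t, b t, c t, d t]) (by
    intro t i; fin_cases i <;> simp [ha, hb, hc, hd])
  simpa [ent, ent4, Fin.sum_univ_four] using this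

lemma ent4_prod (a0 a1 b0 b1 : ℝ) :
    ent4 (a0 * b0) (a1 * b1) (a1 * b0) (a0 * b1) = (b0 + b1) * phi a0 a1 + (a0 + a1) * phi b0 b1 := by
  unfold ent4 phi
  rw [show a0 * b0 + a1 * b1 + a1 * b0 + a0 * b1 = (a0 + a1) * (b0 + b1) by ring]
  simp only [Real.negMulLog_mul]
  ring

lemma ent4_chain (a b c d : ℝ) :
    phi (a + b) (c + d) + (phi a b + phi c d) = ent4 a b c d := by
  unfold phi ent4
  rw [show a + b + (c + d) = a + b + c + d by ring]
  ring

end FP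

namespace FP

section functionals
variable {S V : Type*} [Fintype S] [Fintype V]

/-- total weight -/
noncomputable def wt (μ : S → ℝ) (A : Matrix S S ℝ) : ℝ := ∑ s, ∑ t, μ s * A s t

noncomputable def tri (μ : S → ℝ) (A B : Matrix S S ℝ) : ℝ := ∑ s, ∑ t, ∑ r, μ s * A s t * B t r

noncomputable def fK (μ : S → ℝ) (a b : Matrix S S ℝ) : ℝ := ∑ s, ∑ t, μ s * |a s t - b s t|
noncomputable def fE (μ : S → ℝ) (a b : Matrix S S ℝ) : ℝ := ∑ s, ∑ t, μ s * phi (a s t) (b s t)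
noncomputable def fH (μ : S → ℝ) (a b : Matrix S S ℝ) : ℝ := phi (wt μ a) (wt μ b)
noncomputable def fZ (μ : S → ℝ) (a b : Matrix S S ℝ) : ℝ := 2 * Real.sqrt (wt μ a * wt μ b)

lemma wt_zero (μ : S → ℝ) : wt μ 0 = 0 := by simp [wt]
lemma fK_zero (μ : S → ℝ) : fK μ 0 0 = 0 := by simp [fK]
lemma fE_zero (μ : S → ℝ) : fE μ 0 0 = 0 := by simp [fE, phi_zero]
lemma fH_zero (μ : S → ℝ) : fH μ 0 0 = 0 := by simp [fH, wt_zero, phi_zero]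
lemma fZ_zero (μ : S → ℝ) : fZ μ 0 0 = 0 := by simp [fZ, wt_zero]

lemma wt_add (μ : S → ℝ) (A B : Matrix S S ℝ) : wt μ (A + B) = wt μ A + wt μ B := by
  simp [wt, mul_add, Finset.sum_add_distrib]

lemma wt_sum (μ : S → ℝ) (A : V → Matrix S S ℝ) : wt μ (∑ v, A v) = ∑ v, wt μ (A v) := by
  simp only [wt, Matrix.sum_apply, Finset.mul_sum]
  rw [Finset.sum_comm' (t' := Finset.univ) (s' := fun _ => Finset.univ) (by simp)]
  rw [Finset.sum_congr rfl fun s _ => Finset.sum_comm]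
  rw [Finset.sum_comm]
  refine Finset.sum_congr rfl fun v _ => ?_
  rw [Finset.sum_comm]

lemma wt_mul (μ : S → ℝ) (A B : Matrix S S ℝ) : wt μ (A * B) = tri μ A B := by
  simp only [wt, tri, Matrix.mul_apply, Finset.mul_sum]
  refine Finset.sum_congr rfl fun s _ => ?_
  rw [Finset.sum_comm]
  simp only [mul_assoc]

lemma wt_mono {μ : S → ℝ} (hμ : ∀ s, 0 < μ s) {A B : Matrix S S ℝ} (h : ∀ s t, A s t ≤ B s t) :
    wt μ A ≤ wt μ B :=
  Finset.sum_le_sum fun s _ => Finset.sum_le_sum fun t _ =>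
    mul_le_mul_of_nonneg_left (h s t) (hμ s).le

lemma wt_nonneg {μ : S → ℝ} (hμ : ∀ s, 0 < μ s) {A : Matrix S S ℝ} (h : ∀ s t, 0 ≤ A s t) :
    0 ≤ wt μ A :=
  Finset.sum_nonneg fun s _ => Finset.sum_nonneg fun t _ => mul_nonneg (hμ s).le (h s t)

lemma tri_sum {V' : Type*} [Fintype V'] (μ : S → ℝ) (A : V → Matrix S S ℝ) (B : V' → Matrix S S ℝ) :
    ∑ v, ∑ v', tri μ (A v) (B v') = tri μ (∑ v, A v) (∑ v, B v) := by
  simp only [← wt_mul]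
  rw [Finset.sum_mul_sum, wt_sum]
  refine Finset.sum_congr rfl fun v _ => ?_
  rw [wt_sum]

lemma tri_add_left (μ : S → ℝ) (A A' B : Matrix S S ℝ) :
    tri μ (A + A') B = tri μ A B + tri μ A' B := by
  rw [← wt_mul, add_mul, wt_add, wt_mul, wt_mul]

lemma tri_add_right (μ : S → ℝ) (A B B' : Matrix S S ℝ) :
    tri μ A (B + B') = tri μ A B + tri μ A B' := by
  rw [← wt_mul, mul_add, wt_add, wt_mul, wt_mul]

lemma tri_mono {μ : S → ℝ} (hμ : ∀ s, 0 < μ s) {A B B' : Matrix S S ℝ} (hA : ∀ s t, 0 ≤ A s t)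
    (h : ∀ s t, B s t ≤ B' s t) : tri μ A B ≤ tri μ A B' :=
  Finset.sum_le_sum fun s _ => Finset.sum_le_sum fun t _ => Finset.sum_le_sum fun r _ =>
    mul_le_mul_of_nonneg_left (h t r) (mul_nonneg (hμ s).le (hA s t))

lemma tri_right {μ : S → ℝ} {q : Matrix S S ℝ} (hq : ∀ s, ∑ t, q s t = 1) (A : Matrix S S ℝ) :
    tri μ A q = wt μ A := by
  simp only [tri, wt, ← Finset.mul_sum, hq, mul_one]

lemma tri_left {μ : S → ℝ} {q : Matrix S S ℝ} (hq : ∀ t, ∑ s, μ s * q s t = μ t) (A : Matrix S S ℝ) :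
    tri μ q A = wt μ A := by
  unfold tri wt
  rw [Finset.sum_comm]
  refine Finset.sum_congr rfl fun t _ => ?_
  rw [Finset.sum_comm]
  refine Finset.sum_congr rfl fun r _ => ?_
  rw [← Finset.sum_mul, hq]

lemma tri_le {μ : S → ℝ} (hμ : ∀ s, 0 < μ s) {c : ℝ} (hc : ∀ s, 1 ≤ c * μ s) {A B : Matrix S S ℝ}
    (hA : ∀ s t, 0 ≤ A s t) (hB : ∀ s t, 0 ≤ B s t) : tri μ A B ≤ c * (wt μ A * wt μ B) := by
  have key : ∀ t, ∑ r, B t r ≤ c * wt μ B := by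
    intro t
    have h1 : ∑ r, μ t * B t r ≤ wt μ B :=
      Finset.single_le_sum (f := fun s => ∑ r, μ s * B s r)
        (fun s _ => Finset.sum_nonneg fun r _ => mul_nonneg (hμ s).le (hB s r)) (Finset.mem_univ t)
    have hc0 : 0 ≤ c := by
      by_contra h
      have := hc t
      nlinarith [hμ t]
    have h3 : 0 ≤ ∑ r, B t r := Finset.sum_nonneg fun r _ => hB t r
    calc ∑ r, B t r ≤ (c * μ t) * ∑ r, B t r := by nlinarith [hc t]
      _ = c * ∑ r, μ t * B t r := by rw [← Finset.mul_sum]; ring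
      _ ≤ _ := mul_le_mul_of_nonneg_left h1 hc0
  calc tri μ A B = ∑ s, ∑ t, μ s * A s t * ∑ r, B t r := by simp only [tri, Finset.mul_sum]
    _ ≤ ∑ s, ∑ t, μ s * A s t * (c * wt μ B) :=
        Finset.sum_le_sum fun s _ => Finset.sum_le_sum fun t _ =>
          mul_le_mul_of_nonneg_left (key t) (mul_nonneg (hμ s).le (hA s t))
    _ = c * (wt μ A * wt μ B) := by
        simp only [← Finset.sum_mul]; unfold wt; ring

structure Good (μ : S → ℝ) (c : ℝ) (q : Matrix S S ℝ) (f0 f1 : V → Matrix S S ℝ) : Prop where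
  n0 : ∀ v s t, 0 ≤ f0 v s t
  n1 : ∀ v s t, 0 ≤ f1 v s t
  sm : ∑ v, (f0 v + f1 v) = q
  row : ∀ s, ∑ t, q s t = 1
  stat : ∀ t, ∑ s, μ s * q s t = μ t
  pos : ∀ s, 0 < μ s
  one : ∑ s, μ s = 1
  hc : ∀ s, 1 ≤ c * μ s

variable {μ : S → ℝ} {c : ℝ} {q : Matrix S S ℝ} {f0 f1 : V → Matrix S S ℝ}

/-- entrywise absolute difference -/
def dif (a b : Matrix S S ℝ) : Matrix S S ℝ := fun s t => |a s t - b s t|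

lemma dif_nonneg (a b : Matrix S S ℝ) (s t : S) : 0 ≤ dif a b s t := abs_nonneg _

lemma fK_eq (a b : Matrix S S ℝ) : fK μ a b = wt μ (dif a b) := rfl

lemma Good.wt_q (g : Good μ c q f0 f1) : wt μ q = 1 := by
  simp only [wt, ← Finset.mul_sum, g.row, mul_one, g.one]

lemma Good.sum_wt (g : Good μ c q f0 f1) : ∑ v, (wt μ (f0 v) + wt μ (f1 v)) = 1 := by
  simp only [← wt_add]; rw [← wt_sum, g.sm, g.wt_q]

lemma Good.c_nonneg (g : Good μ c q f0 f1) [Nonempty S] : 0 ≤ c := by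
  obtain ⟨s⟩ := ‹Nonempty S›
  by_contra h
  nlinarith [g.hc s, g.pos s]

lemma Good.K_minus (g : Good μ c q f0 f1) :
    ∑ v, ∑ v', fK μ (f0 v * f0 v' + f1 v * f1 v') (f1 v * f0 v' + f0 v * f1 v')
      ≤ c * (∑ v, fK μ (f0 v) (f1 v)) ^ 2 := by
  have h1 : ∀ v v', fK μ (f0 v * f0 v' + f1 v * f1 v') (f1 v * f0 v' + f0 v * f1 v')
      ≤ tri μ (dif (f0 v) (f1 v)) (dif (f0 v') (f1 v')) := by
    intro v v'
    rw [fK_eq, ← wt_mul]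
    apply wt_mono g.pos
    intro s r
    have : dif (f0 v * f0 v' + f1 v * f1 v') (f1 v * f0 v' + f0 v * f1 v') s r
        = |∑ t, (f0 v s t - f1 v s t) * (f0 v' t r - f1 v' t r)| := by
      simp only [dif, Matrix.add_apply, Matrix.mul_apply, ← Finset.sum_add_distrib,
        ← Finset.sum_sub_distrib]
      congr 1
      exact Finset.sum_congr rfl fun t _ => by ring
    rw [this, Matrix.mul_apply]
    refine (Finset.abs_sum_le_sum_abs _ _).trans (le_of_eq ?_)
    simp only [dif, abs_mul]
  calc _ ≤ ∑ v, ∑ v', tri μ (dif (f0 v) (f1 v)) (dif (f0 v') (f1 v')) :=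
        Finset.sum_le_sum fun v _ => Finset.sum_le_sum fun v' _ => h1 v v'
    _ = tri μ (∑ v, dif (f0 v) (f1 v)) (∑ v, dif (f0 v) (f1 v)) := tri_sum _ _ _
    _ ≤ _ := by
      have hn : ∀ s t, 0 ≤ (∑ v, dif (f0 v) (f1 v)) s t := by
        intro s t; rw [Matrix.sum_apply]; exact Finset.sum_nonneg fun v _ => dif_nonneg _ _ _ _
      refine (tri_le g.pos g.hc hn hn).trans (le_of_eq ?_)
      rw [wt_sum, sq]; rfl

lemma fK_mul_le (hμ : ∀ s, 0 < μ s) {a b a' b' : Matrix S S ℝ} (ha : ∀ s t, 0 ≤ a s t)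
    (hb' : ∀ s t, 0 ≤ b' s t) :
    fK μ (a * a') (b * b') ≤ tri μ a (dif a' b') + tri μ (dif a b) b' := by
  rw [fK_eq, ← wt_mul, ← wt_mul, ← wt_add]
  apply wt_mono hμ
  intro s r
  have : dif (a * a') (b * b') s r = |∑ t, (a s t * (a' t r - b' t r) + (a s t - b s t) * b' t r)| := by
    simp only [dif, Matrix.mul_apply, ← Finset.sum_sub_distrib]
    congr 1
    exact Finset.sum_congr rfl fun t _ => by ring
  rw [this, Matrix.add_apply, Matrix.mul_apply, Matrix.mul_apply, ← Finset.sum_add_distrib]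
  refine (Finset.abs_sum_le_sum_abs _ _).trans (Finset.sum_le_sum fun t _ => ?_)
  refine (abs_add_le _ _).trans (le_of_eq ?_)
  simp only [dif, abs_mul, abs_of_nonneg (ha s t), abs_of_nonneg (hb' t r)]

lemma dif_comm (a b : Matrix S S ℝ) : dif a b = dif b a := by
  ext s t; exact abs_sub_comm _ _

lemma Good.K_plus (g : Good μ c q f0 f1) :
    ∑ v, ∑ v', (fK μ (f0 v * f0 v') (f1 v * f1 v') + fK μ (f1 v * f0 v') (f0 v * f1 v'))
      ≤ 3 * (∑ v, fK μ (f0 v) (f1 v)) := by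
  set D : V → Matrix S S ℝ := fun v => dif (f0 v) (f1 v) with hD
  have hn : ∀ s t, 0 ≤ (∑ v, D v) s t := by
    intro s t; rw [Matrix.sum_apply]; exact Finset.sum_nonneg fun v _ => dif_nonneg _ _ _ _
  have h1 : ∀ v v', fK μ (f0 v * f0 v') (f1 v * f1 v') + fK μ (f1 v * f0 v') (f0 v * f1 v') ≤
      tri μ (f0 v + f1 v) (D v') + 2 * tri μ (D v) (f1 v') := by
    intro v v'
    have a := fK_mul_le g.pos (a := f0 v) (b := f1 v) (a' := f0 v') (b' := f1 v') (g.n0 v) (g.n1 v')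
    have b := fK_mul_le g.pos (a := f1 v) (b := f0 v) (a' := f0 v') (b' := f1 v') (g.n1 v) (g.n1 v')
    rw [dif_comm (f1 v)] at b
    rw [tri_add_left]
    simp only [hD]
    linarith
  calc _ ≤ ∑ v, ∑ v', (tri μ (f0 v + f1 v) (D v') + 2 * tri μ (D v) (f1 v')) :=
        Finset.sum_le_sum fun v _ => Finset.sum_le_sum fun v' _ => h1 v v'
    _ = tri μ q (∑ v, D v) + 2 * tri μ (∑ v, D v) (∑ v, f1 v) := by
        simp only [Finset.sum_add_distrib, ← Finset.mul_sum]
        rw [tri_sum, tri_sum, g.sm]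
    _ ≤ tri μ q (∑ v, D v) + 2 * tri μ (∑ v, D v) q := by
        have : tri μ (∑ v, D v) (∑ v, f1 v) ≤ tri μ (∑ v, D v) q := by
          apply tri_mono g.pos hn
          intro s t
          rw [← g.sm, Matrix.sum_apply, Matrix.sum_apply]
          exact Finset.sum_le_sum fun v _ => by
            rw [Matrix.add_apply]; linarith [g.n0 v s t]
        linarith
    _ = _ := by
        rw [tri_left g.stat, tri_right g.row, wt_sum]
        simp only [fK_eq, hD]; ring

lemma sqrt_minus {a0 a1 b0 b1 : ℝ} (ha0 : 0 ≤ a0) (ha1 : 0 ≤ a1) (hb0 : 0 ≤ b0) (hb1 : 0 ≤ b1) :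
    Real.sqrt ((a0 * b0 + a1 * b1) * (a1 * b0 + a0 * b1)) ≤
      Real.sqrt (a0 * a1) * (b0 + b1) + (a0 + a1) * Real.sqrt (b0 * b1) := by
  apply Real.sqrt_le_iff.2
  refine ⟨by positivity, ?_⟩
  have e1 := Real.sq_sqrt (mul_nonneg ha0 ha1)
  have e2 := Real.sq_sqrt (mul_nonneg hb0 hb1)
  have p1 := Real.sqrt_nonneg (a0 * a1)
  have p2 := Real.sqrt_nonneg (b0 * b1)
  set x := Real.sqrt (a0 * a1)
  set y := Real.sqrt (b0 * b1)
  have : (x * (b0 + b1) + (a0 + a1) * y) ^ 2 = x ^ 2 * (b0 + b1) ^ 2 + (a0 + a1) ^ 2 * y ^ 2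
    + 2 * (x * y * ((b0 + b1) * (a0 + a1))) := by ring
  rw [this, e1, e2]
  have h1 : 0 ≤ x * y * ((b0 + b1) * (a0 + a1)) := by positivity
  have h2 : 0 ≤ (a0 * a1) * (b0 * b1) := by positivity
  nlinarith

lemma Good.Z_minus (g : Good μ c q f0 f1) [Nonempty S] :
    ∑ v, ∑ v', fZ μ (f0 v * f0 v' + f1 v * f1 v') (f1 v * f0 v' + f0 v * f1 v')
      ≤ 2 * c * (∑ v, fZ μ (f0 v) (f1 v)) := by
  have hc0 := g.c_nonneg
  have w0 := fun v => wt_nonneg g.pos (g.n0 v)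
  have w1 := fun v => wt_nonneg g.pos (g.n1 v)
  have h1 : ∀ v v', fZ μ (f0 v * f0 v' + f1 v * f1 v') (f1 v * f0 v' + f0 v * f1 v') ≤
      c * (fZ μ (f0 v) (f1 v) * (wt μ (f0 v') + wt μ (f1 v'))
        + (wt μ (f0 v) + wt μ (f1 v)) * fZ μ (f0 v') (f1 v')) := by
    intro v v'
    have a00 := tri_le g.pos g.hc (g.n0 v) (g.n0 v')
    have a01 := tri_le g.pos g.hc (g.n0 v) (g.n1 v')
    have a10 := tri_le g.pos g.hc (g.n1 v) (g.n0 v')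
    have a11 := tri_le g.pos g.hc (g.n1 v) (g.n1 v')
    have t00 : 0 ≤ tri μ (f1 v) (f0 v') + tri μ (f0 v) (f1 v') := by
      have : ∀ A B : Matrix S S ℝ, (∀ s t, 0 ≤ A s t) → (∀ s t, 0 ≤ B s t) → 0 ≤ tri μ A B :=
        fun A B hA hB => Finset.sum_nonneg fun s _ => Finset.sum_nonneg fun t _ =>
          Finset.sum_nonneg fun r _ => mul_nonneg (mul_nonneg (g.pos s).le (hA s t)) (hB t r)
      exact add_nonneg (this _ _ (g.n1 v) (g.n0 v')) (this _ _ (g.n0 v) (g.n1 v'))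
    unfold fZ
    rw [wt_add, wt_add, wt_mul, wt_mul, wt_mul, wt_mul]
    have := sqrt_minus (w0 v) (w1 v) (w0 v') (w1 v')
    have hs : Real.sqrt ((tri μ (f0 v) (f0 v') + tri μ (f1 v) (f1 v')) *
        (tri μ (f1 v) (f0 v') + tri μ (f0 v) (f1 v'))) ≤
        c * Real.sqrt ((wt μ (f0 v) * wt μ (f0 v') + wt μ (f1 v) * wt μ (f1 v')) *
          (wt μ (f1 v) * wt μ (f0 v') + wt μ (f0 v) * wt μ (f1 v'))) := by
      rw [← Real.sqrt_sq hc0, ← Real.sqrt_mul (sq_nonneg c)]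
      apply Real.sqrt_le_sqrt
      calc _ ≤ (c * (wt μ (f0 v) * wt μ (f0 v') + wt μ (f1 v) * wt μ (f1 v'))) *
          (c * (wt μ (f1 v) * wt μ (f0 v') + wt μ (f0 v) * wt μ (f1 v'))) := by
            apply mul_le_mul (by linarith) (by linarith) t00
            have := w0 v; have := w1 v; have := w0 v'; have := w1 v'
            positivity
        _ = _ := by ring
    have h3 := mul_le_mul_of_nonneg_left this hc0
    nlinarith
  calc _ ≤ ∑ v, ∑ v', c * (fZ μ (f0 v) (f1 v) * (wt μ (f0 v') + wt μ (f1 v'))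
        + (wt μ (f0 v) + wt μ (f1 v)) * fZ μ (f0 v') (f1 v')) :=
        Finset.sum_le_sum fun v _ => Finset.sum_le_sum fun v' _ => h1 v v'
    _ = c * ((∑ v, fZ μ (f0 v) (f1 v)) * (∑ v, (wt μ (f0 v) + wt μ (f1 v)))
        + (∑ v, (wt μ (f0 v) + wt μ (f1 v))) * (∑ v, fZ μ (f0 v) (f1 v))) := by
        rw [Finset.sum_mul_sum, Finset.sum_mul_sum]
        simp only [← Finset.mul_sum, Finset.sum_add_distrib]
    _ = _ := by rw [g.sum_wt]; ring

lemma Good.Z_plus (g : Good μ c q f0 f1) [Nonempty S] :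
    ∑ v, ∑ v', (fZ μ (f0 v * f0 v') (f1 v * f1 v') + fZ μ (f1 v * f0 v') (f0 v * f1 v'))
      ≤ c * (∑ v, fZ μ (f0 v) (f1 v)) ^ 2 := by
  have hc0 := g.c_nonneg
  have w0 := fun v => wt_nonneg g.pos (g.n0 v)
  have w1 := fun v => wt_nonneg g.pos (g.n1 v)
  have tn : ∀ A B : Matrix S S ℝ, (∀ s t, 0 ≤ A s t) → (∀ s t, 0 ≤ B s t) → 0 ≤ tri μ A B :=
        fun A B hA hB => Finset.sum_nonneg fun s _ => Finset.sum_nonneg fun t _ =>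
          Finset.sum_nonneg fun r _ => mul_nonneg (mul_nonneg (g.pos s).le (hA s t)) (hB t r)
  have aux : ∀ A B A' B' : Matrix S S ℝ, (∀ s t, 0 ≤ A s t) → (∀ s t, 0 ≤ B s t) →
      (∀ s t, 0 ≤ A' s t) → (∀ s t, 0 ≤ B' s t) →
      fZ μ (A * A') (B * B') ≤ c * (fZ μ A B * fZ μ A' B') / 2 := by
    intro A B A' B' hA hB hA' hB'
    unfold fZ
    rw [wt_mul, wt_mul]
    have wA := wt_nonneg g.pos hA
    have wB := wt_nonneg g.pos hB
    have wA' := wt_nonneg g.pos hA'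
    have wB' := wt_nonneg g.pos hB'
    have : Real.sqrt (tri μ A A' * tri μ B B') ≤
        c * (Real.sqrt (wt μ A * wt μ B) * Real.sqrt (wt μ A' * wt μ B')) := by
      rw [← Real.sqrt_mul (by positivity), ← Real.sqrt_sq hc0, ← Real.sqrt_mul (sq_nonneg c)]
      apply Real.sqrt_le_sqrt
      calc _ ≤ (c * (wt μ A * wt μ A')) * (c * (wt μ B * wt μ B')) :=
            mul_le_mul (tri_le g.pos g.hc hA hA') (tri_le g.pos g.hc hB hB') (tn _ _ hB hB')
              (by positivity)
        _ = _ := by ring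
    linarith
  have comm : ∀ A B : Matrix S S ℝ, fZ μ A B = fZ μ B A := by
    intro A B; unfold fZ; rw [mul_comm (wt μ A)]
  calc _ ≤ ∑ v, ∑ v', c * (fZ μ (f0 v) (f1 v) * fZ μ (f0 v') (f1 v')) := by
        refine Finset.sum_le_sum fun v _ => Finset.sum_le_sum fun v' _ => ?_
        have a := aux _ _ _ _ (g.n0 v) (g.n1 v) (g.n0 v') (g.n1 v')
        have b := aux _ _ _ _ (g.n1 v) (g.n0 v) (g.n0 v') (g.n1 v')
        rw [comm (f1 v) (f0 v)] at b
        linarith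
    _ = _ := by
        simp only [← Finset.mul_sum]
        rw [sq, Finset.sum_mul_sum]
        simp only [← Finset.mul_sum]

end functionals
end FP

namespace FP

section functionals2
variable {S V : Type*} [Fintype S] [Fintype V]
variable {μ : S → ℝ} {c : ℝ} {q : Matrix S S ℝ} {f0 f1 : V → Matrix S S ℝ}

noncomputable def phM (a b : Matrix S S ℝ) : Matrix S S ℝ := fun s t => phi (a s t) (b s t)
noncomputable def taM (a b : Matrix S S ℝ) : Matrix S S ℝ := fun s t => tau (a s t) (b s t)

lemma fE_eq (a b : Matrix S S ℝ) : fE μ a b = wt μ (phM a b) := rfl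

lemma wt_smul (r : ℝ) (A : Matrix S S ℝ) : wt μ (r • A) = r * wt μ A := by
  simp only [wt, Matrix.smul_apply, smul_eq_mul, Finset.mul_sum]
  exact Finset.sum_congr rfl fun s _ => Finset.sum_congr rfl fun t _ => by ring

lemma wt_sub (A B : Matrix S S ℝ) : wt μ (A - B) = wt μ A - wt μ B := by
  simp [wt, mul_sub, Finset.sum_sub_distrib]

lemma Good.E_minus (g : Good μ c q f0 f1) :
    (∑ v, fE μ (f0 v) (f1 v)) + (1/2) * tri μ (∑ v, taM (f0 v) (f1 v)) (q - ∑ v, taM (f0 v) (f1 v)) ≤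
    ∑ v, ∑ v', fE μ (f0 v * f0 v' + f1 v * f1 v') (f1 v * f0 v' + f0 v * f1 v') := by
  have h1 : ∀ v v', tri μ (phM (f0 v) (f1 v)) (f0 v' + f1 v') +
      (1/2) * tri μ (taM (f0 v) (f1 v)) (f0 v' + f1 v' - taM (f0 v') (f1 v')) ≤
      fE μ (f0 v * f0 v' + f1 v * f1 v') (f1 v * f0 v' + f0 v * f1 v') := by
    intro v v'
    rw [fE_eq, ← wt_mul, ← wt_mul, ← wt_smul, ← wt_add]
    apply wt_mono g.pos
    intro s r
    simp only [phM, Matrix.add_apply, Matrix.mul_apply, Matrix.smul_apply, smul_eq_mul,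
      ← Finset.sum_add_distrib, Matrix.sub_apply, taM]
    have p00 := fun t => mul_nonneg (g.n0 v s t) (g.n0 v' t r)
    have p01 := fun t => mul_nonneg (g.n0 v s t) (g.n1 v' t r)
    have p10 := fun t => mul_nonneg (g.n1 v s t) (g.n0 v' t r)
    have p11 := fun t => mul_nonneg (g.n1 v s t) (g.n1 v' t r)
    refine le_trans ?_ (phi_superadd _ _ (fun t => add_nonneg (p00 t) (p11 t))
      (fun t => add_nonneg (p10 t) (p01 t)))
    rw [Finset.mul_sum, ← Finset.sum_add_distrib]
    refine Finset.sum_le_sum fun t _ => ?_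
    have := phi_gain (g.n0 v s t) (g.n1 v s t) (g.n0 v' t r) (g.n1 v' t r)
    linarith
  refine le_trans (le_of_eq ?_)
    (Finset.sum_le_sum fun v _ => Finset.sum_le_sum fun v' _ => h1 v v')
  simp only [Finset.sum_add_distrib, ← Finset.mul_sum]
  rw [tri_sum, tri_sum, g.sm, tri_right g.row, wt_sum, Finset.sum_sub_distrib, g.sm]
  rfl

lemma Good.E_pm (g : Good μ c q f0 f1) :
    2 * (∑ v, fE μ (f0 v) (f1 v)) ≤
    (∑ v, ∑ v', fE μ (f0 v * f0 v' + f1 v * f1 v') (f1 v * f0 v' + f0 v * f1 v')) +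
    ∑ v, ∑ v', (fE μ (f0 v * f0 v') (f1 v * f1 v') + fE μ (f1 v * f0 v') (f0 v * f1 v')) := by
  simp only [← Finset.sum_add_distrib]
  have h1 : ∀ v v', tri μ (phM (f0 v) (f1 v)) (f0 v' + f1 v') +
      tri μ (f0 v + f1 v) (phM (f0 v') (f1 v')) ≤
      fE μ (f0 v * f0 v' + f1 v * f1 v') (f1 v * f0 v' + f0 v * f1 v') +
      (fE μ (f0 v * f0 v') (f1 v * f1 v') + fE μ (f1 v * f0 v') (f0 v * f1 v')) := by
    intro v v'
    rw [fE_eq, fE_eq, fE_eq, ← wt_mul, ← wt_mul, ← wt_add, ← wt_add, ← wt_add]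
    apply wt_mono g.pos
    intro s r
    simp only [phM, Matrix.add_apply, Matrix.mul_apply]
    rw [ent4_chain]
    have p00 := fun t => mul_nonneg (g.n0 v s t) (g.n0 v' t r)
    have p01 := fun t => mul_nonneg (g.n0 v s t) (g.n1 v' t r)
    have p10 := fun t => mul_nonneg (g.n1 v s t) (g.n0 v' t r)
    have p11 := fun t => mul_nonneg (g.n1 v s t) (g.n1 v' t r)
    refine le_trans ?_ (ent4_superadd _ _ _ _ p00 p11 p10 p01)
    rw [← Finset.sum_add_distrib]
    refine Finset.sum_le_sum fun t _ => ?_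
    rw [ent4_prod]
    linarith
  refine le_trans (le_of_eq ?_)
    (Finset.sum_le_sum fun v _ => Finset.sum_le_sum fun v' _ => h1 v v')
  simp only [Finset.sum_add_distrib]
  rw [tri_sum, tri_sum, g.sm, tri_right g.row, tri_left g.stat, wt_sum]
  simp only [fE_eq]; ring

lemma Good.E_nonneg (g : Good μ c q f0 f1) : 0 ≤ ∑ v, fE μ (f0 v) (f1 v) :=
  Finset.sum_nonneg fun v _ => wt_nonneg g.pos (A := phM (f0 v) (f1 v))
    fun s t => phi_nonneg (g.n0 v s t) (g.n1 v s t)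

lemma Good.H_nonneg (g : Good μ c q f0 f1) : 0 ≤ ∑ v, fH μ (f0 v) (f1 v) :=
  Finset.sum_nonneg fun v _ => phi_nonneg (wt_nonneg g.pos (g.n0 v)) (wt_nonneg g.pos (g.n1 v))

lemma Good.K_nonneg (g : Good μ c q f0 f1) : 0 ≤ ∑ v, fK μ (f0 v) (f1 v) :=
  Finset.sum_nonneg fun v _ => wt_nonneg g.pos (dif_nonneg _ _)

lemma Good.Z_nonneg : 0 ≤ ∑ v, fZ μ (f0 v) (f1 v) :=
  Finset.sum_nonneg fun v _ => by unfold fZ; positivity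

lemma Good.H_le (g : Good μ c q f0 f1) : ∑ v, fH μ (f0 v) (f1 v) ≤ Real.log 2 := by
  calc _ ≤ ∑ v, Real.log 2 * (wt μ (f0 v) + wt μ (f1 v)) := Finset.sum_le_sum fun v _ =>
        phi_le_log (wt_nonneg g.pos (g.n0 v)) (wt_nonneg g.pos (g.n1 v))
    _ = _ := by rw [← Finset.mul_sum, g.sum_wt, mul_one]

lemma Good.E_le_H (g : Good μ c q f0 f1) :
    ∑ v, fE μ (f0 v) (f1 v) ≤ ∑ v, fH μ (f0 v) (f1 v) := by
  refine Finset.sum_le_sum fun v _ => ?_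
  unfold fE fH wt
  rw [← Fintype.sum_prod_type' (f := fun s t => μ s * phi (f0 v s t) (f1 v s t)),
    ← Fintype.sum_prod_type' (f := fun s t => μ s * f0 v s t),
    ← Fintype.sum_prod_type' (f := fun s t => μ s * f1 v s t)]
  simp only [← phi_smul]
  exact phi_superadd (fun x : S × S => μ x.1 * f0 v x.1 x.2) (fun x => μ x.1 * f1 v x.1 x.2)
    (fun x => mul_nonneg (g.pos _).le (g.n0 _ _ _)) (fun x => mul_nonneg (g.pos _).le (g.n1 _ _ _))

lemma Good.H_le_Z (g : Good μ c q f0 f1) :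
    ∑ v, fH μ (f0 v) (f1 v) ≤ ∑ v, fZ μ (f0 v) (f1 v) :=
  Finset.sum_le_sum fun v _ => phi_le_sqrt (wt_nonneg g.pos (g.n0 v)) (wt_nonneg g.pos (g.n1 v))

lemma four_mul_eq {a b : ℝ} (ha : 0 ≤ a) (hb : 0 ≤ b) :
    4 * (a * b) = (a + b) * ((a + b) - tau a b) := by
  unfold tau
  by_cases h : a + b = 0
  · have : a = 0 := by linarith
    rw [h, this]; simp
  · field_simp; ring

lemma Good.Z_sq (g : Good μ c q f0 f1) :
    (∑ v, fZ μ (f0 v) (f1 v)) ^ 2 ≤ 2 * ∑ v, fH μ (f0 v) (f1 v) := by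
  have w0 := fun v => wt_nonneg g.pos (g.n0 v)
  have w1 := fun v => wt_nonneg g.pos (g.n1 v)
  have := Finset.sum_sq_le_sum_mul_sum_of_sq_eq_mul Finset.univ
    (f := fun v => wt μ (f0 v) + wt μ (f1 v))
    (g := fun v => wt μ (f0 v) + wt μ (f1 v) - tau (wt μ (f0 v)) (wt μ (f1 v)))
    (r := fun v => fZ μ (f0 v) (f1 v)) (fun v _ => add_nonneg (w0 v) (w1 v))
    (fun v _ => sub_nonneg.2 (tau_le_add (w0 v) (w1 v)))
    (fun v _ => by
      rw [← four_mul_eq (w0 v) (w1 v)]; unfold fZ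
      rw [mul_pow, Real.sq_sqrt (mul_nonneg (w0 v) (w1 v))]; ring)
  refine this.trans ?_
  rw [g.sum_wt, one_mul, Finset.mul_sum]
  exact Finset.sum_le_sum fun v _ => phi_ge (w0 v) (w1 v)

/-- total tau -/
noncomputable def That (μ : S → ℝ) (f0 f1 : V → Matrix S S ℝ) : ℝ := wt μ (∑ v, taM (f0 v) (f1 v))

lemma Good.E_le_one_sub (g : Good μ c q f0 f1) :
    (∑ v, fE μ (f0 v) (f1 v)) ^ 2 ≤ 1 - That μ f0 f1 := by
  let r : V × S × S → ℝ := fun x => μ x.2.1 * (2 * Real.sqrt (f0 x.1 x.2.1 x.2.2 * f1 x.1 x.2.1 x.2.2))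
  let F : V × S × S → ℝ := fun x => μ x.2.1 * (f0 x.1 x.2.1 x.2.2 + f1 x.1 x.2.1 x.2.2)
  let G : V × S × S → ℝ := fun x => μ x.2.1 * (f0 x.1 x.2.1 x.2.2 + f1 x.1 x.2.1 x.2.2
    - tau (f0 x.1 x.2.1 x.2.2) (f1 x.1 x.2.1 x.2.2))
  have hF : ∑ x, F x = 1 := by
    rw [← g.wt_q, ← g.sm, wt_sum, Fintype.sum_prod_type]
    refine Finset.sum_congr rfl fun v _ => ?_
    rw [Fintype.sum_prod_type]; rfl
  have hG : ∑ x, G x = 1 - That μ f0 f1 := by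
    rw [← g.wt_q, That, ← wt_sub, ← g.sm, ← Finset.sum_sub_distrib, wt_sum, Fintype.sum_prod_type]
    refine Finset.sum_congr rfl fun v _ => ?_
    rw [Fintype.sum_prod_type]; rfl
  have hr : ∑ v, fE μ (f0 v) (f1 v) ≤ ∑ x, r x := by
    rw [Fintype.sum_prod_type]
    refine Finset.sum_le_sum fun v _ => ?_
    rw [Fintype.sum_prod_type]
    refine Finset.sum_le_sum fun s _ => Finset.sum_le_sum fun t _ => ?_
    exact mul_le_mul_of_nonneg_left (phi_le_sqrt (g.n0 v s t) (g.n1 v s t)) (g.pos s).le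
  have := Finset.sum_sq_le_sum_mul_sum_of_sq_eq_mul Finset.univ (f := F) (g := G) (r := r)
    (fun x _ => mul_nonneg (g.pos _).le (add_nonneg (g.n0 _ _ _) (g.n1 _ _ _)))
    (fun x _ => mul_nonneg (g.pos _).le (sub_nonneg.2 (tau_le_add (g.n0 _ _ _) (g.n1 _ _ _))))
    (fun x _ => by
      have := four_mul_eq (g.n0 x.1 x.2.1 x.2.2) (g.n1 x.1 x.2.1 x.2.2)
      simp only [r, F, G]
      rw [mul_pow, mul_pow, Real.sq_sqrt (mul_nonneg (g.n0 _ _ _) (g.n1 _ _ _))]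
      linear_combination (μ x.2.1) ^ 2 * this)
  rw [hF, hG, one_mul] at this
  exact (pow_le_pow_left₀ g.E_nonneg hr 2).trans this

lemma Good.K_sq (g : Good μ c q f0 f1) :
    (∑ v, fK μ (f0 v) (f1 v)) ^ 2 ≤ That μ f0 f1 := by
  let r : V × S × S → ℝ := fun x => μ x.2.1 * |f0 x.1 x.2.1 x.2.2 - f1 x.1 x.2.1 x.2.2|
  let F : V × S × S → ℝ := fun x => μ x.2.1 * (f0 x.1 x.2.1 x.2.2 + f1 x.1 x.2.1 x.2.2)
  let G : V × S × S → ℝ := fun x => μ x.2.1 * (tau (f0 x.1 x.2.1 x.2.2) (f1 x.1 x.2.1 x.2.2))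
  have hF : ∑ x, F x = 1 := by
    rw [← g.wt_q, ← g.sm, wt_sum, Fintype.sum_prod_type]
    refine Finset.sum_congr rfl fun v _ => ?_
    rw [Fintype.sum_prod_type]; rfl
  have hG : ∑ x, G x = That μ f0 f1 := by
    rw [That, wt_sum, Fintype.sum_prod_type]
    refine Finset.sum_congr rfl fun v _ => ?_
    rw [Fintype.sum_prod_type]; rfl
  have hr : ∑ v, fK μ (f0 v) (f1 v) = ∑ x, r x := by
    rw [Fintype.sum_prod_type]
    refine Finset.sum_congr rfl fun v _ => ?_
    rw [Fintype.sum_prod_type]; rfl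
  have := Finset.sum_sq_le_sum_mul_sum_of_sq_eq_mul Finset.univ (f := F) (g := G) (r := r)
    (fun x _ => mul_nonneg (g.pos _).le (add_nonneg (g.n0 _ _ _) (g.n1 _ _ _)))
    (fun x _ => mul_nonneg (g.pos _).le (tau_nonneg (g.n0 _ _ _) (g.n1 _ _ _)))
    (fun x _ => by
      simp only [r, F, G]
      rw [mul_pow, sq_abs]
      have : (f0 x.1 x.2.1 x.2.2 + f1 x.1 x.2.1 x.2.2) * tau (f0 x.1 x.2.1 x.2.2) (f1 x.1 x.2.1 x.2.2)
        = (f0 x.1 x.2.1 x.2.2 - f1 x.1 x.2.1 x.2.2) ^ 2 := by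
        have h0 := g.n0 x.1 x.2.1 x.2.2
        have h1 := g.n1 x.1 x.2.1 x.2.2
        unfold tau
        by_cases h : f0 x.1 x.2.1 x.2.2 + f1 x.1 x.2.1 x.2.2 = 0
        · have : f0 x.1 x.2.1 x.2.2 = 0 := by linarith
          have : f1 x.1 x.2.1 x.2.2 = 0 := by linarith
          simp [*]
        · field_simp
      linear_combination -(μ x.2.1) ^ 2 * this)
  rw [hF, hG, one_mul] at this
  rw [hr]; exact this

lemma Good.log_sub_H_le_K (g : Good μ c q f0 f1) :
    Real.log 2 - ∑ v, fH μ (f0 v) (f1 v) ≤ ∑ v, fK μ (f0 v) (f1 v) := by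
  have h1 : Real.log 2 - ∑ v, fE μ (f0 v) (f1 v) ≤ ∑ v, fK μ (f0 v) (f1 v) := by
    have : Real.log 2 = ∑ v, Real.log 2 * wt μ (f0 v + f1 v) := by
      rw [← Finset.mul_sum, ← wt_sum, g.sm, g.wt_q, mul_one]
    rw [this, ← Finset.sum_sub_distrib]
    refine Finset.sum_le_sum fun v _ => ?_
    rw [← wt_smul, fE_eq, ← wt_sub, fK_eq]
    apply wt_mono g.pos
    intro s t
    exact (log_two_sub_phi (g.n0 v s t) (g.n1 v s t)).trans (tau_le_abs (g.n0 v s t) (g.n1 v s t))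
  linarith [g.E_le_H]

lemma Good.one_sub_K_le_Z (g : Good μ c q f0 f1) :
    1 - ∑ v, fK μ (f0 v) (f1 v) ≤ ∑ v, fZ μ (f0 v) (f1 v) := by
  rw [← g.sum_wt, ← Finset.sum_sub_distrib]
  refine Finset.sum_le_sum fun v _ => ?_
  have w0 := wt_nonneg g.pos (g.n0 v)
  have w1 := wt_nonneg g.pos (g.n1 v)
  have h : |wt μ (f0 v) - wt μ (f1 v)| ≤ fK μ (f0 v) (f1 v) := by
    rw [← wt_sub]
    unfold wt fK
    refine (Finset.abs_sum_le_sum_abs _ _).trans (Finset.sum_le_sum fun s _ => ?_)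
    refine (Finset.abs_sum_le_sum_abs _ _).trans (Finset.sum_le_sum fun t _ => ?_)
    rw [abs_mul, abs_of_pos (g.pos s)]; rfl
  unfold fZ
  set a := wt μ (f0 v)
  set b := wt μ (f1 v)
  have : a + b - |a - b| ≤ 2 * Real.sqrt (a * b) := by
    rcases le_total a b with hab | hab
    · rw [abs_of_nonpos (by linarith)]
      have : a ≤ Real.sqrt (a * b) := Real.le_sqrt_of_sq_le (by nlinarith)
      linarith
    · rw [abs_of_nonneg (by linarith)]
      have : b ≤ Real.sqrt (a * b) := Real.le_sqrt_of_sq_le (by nlinarith)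
      linarith
  linarith

/-- dichotomy -/
lemma Good.dichotomy (g : Good μ c q f0 f1) [Nonempty S] {w δ : ℝ} (hw : ∀ s t, w ≤ q s t) (hδ : 0 < δ)
    (hδw : 2 * δ < w)
    (hM : c * tri μ (∑ v, taM (f0 v) (f1 v)) (q - ∑ v, taM (f0 v) (f1 v)) ≤ δ ^ 2) :
    That μ f0 f1 ≤ Fintype.card S * δ ∨ 1 - That μ f0 f1 ≤ Fintype.card S * δ := by
  set T := ∑ v, taM (f0 v) (f1 v) with hT
  have T0 : ∀ s t, 0 ≤ T s t := by
    intro s t; rw [hT, Matrix.sum_apply]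
    exact Finset.sum_nonneg fun v _ => tau_nonneg (g.n0 v s t) (g.n1 v s t)
  have Tq : ∀ s t, 0 ≤ (q - T) s t := by
    intro s t; rw [hT, ← g.sm, ← Finset.sum_sub_distrib, Matrix.sum_apply]
    exact Finset.sum_nonneg fun v _ => sub_nonneg.2 (tau_le_add (g.n0 v s t) (g.n1 v s t))
  have hc0 := g.c_nonneg
  have key : ∀ s t r, T s t * (q - T) t r ≤ δ ^ 2 := by
    intro s t r
    have h1 : μ s * T s t * (q - T) t r ≤ tri μ T (q - T) := by
      have nn : ∀ s t r, 0 ≤ μ s * T s t * (q - T) t r := fun s t r =>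
        mul_nonneg (mul_nonneg (g.pos s).le (T0 s t)) (Tq t r)
      calc _ ≤ ∑ r, μ s * T s t * (q - T) t r :=
            Finset.single_le_sum (f := fun r => μ s * T s t * (q - T) t r) (fun r _ => nn s t r) (Finset.mem_univ r)
        _ ≤ ∑ t, ∑ r, μ s * T s t * (q - T) t r :=
            Finset.single_le_sum (f := fun t => ∑ r, μ s * T s t * (q - T) t r)
              (fun t _ => Finset.sum_nonneg fun r _ => nn s t r) (Finset.mem_univ t)
        _ ≤ _ := Finset.single_le_sum (f := fun s => ∑ t, ∑ r, μ s * T s t * (q - T) t r)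
              (fun s _ => Finset.sum_nonneg fun t _ => Finset.sum_nonneg fun r _ => nn s t r) (Finset.mem_univ s)
    have h2 := mul_le_mul_of_nonneg_left h1 hc0
    have h3 : 0 ≤ T s t * (q - T) t r := mul_nonneg (T0 s t) (Tq t r)
    nlinarith [g.hc s]
  have wtb : ∀ A : Matrix S S ℝ, (∀ s t, A s t ≤ δ) → wt μ A ≤ Fintype.card S * δ := by
    intro A hA
    calc wt μ A ≤ ∑ s, ∑ t : S, μ s * δ := wt_mono g.pos (B := fun _ _ => δ) hA
      _ = _ := by
        simp only [Finset.sum_const, nsmul_eq_mul, ← Finset.mul_sum, ← Finset.sum_mul, g.one, Finset.card_univ]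
        ring
  by_cases h : ∀ s t, T s t ≤ δ
  · left; exact wtb _ h
  · right
    push Not at h
    obtain ⟨s0, t0, h0⟩ := h
    have e1 : ∀ r, (q - T) t0 r < δ := by
      intro r
      by_contra hh; push Not at hh
      nlinarith [key s0 t0 r]
    -- hence T t0 r > δ for all r
    have e2 : ∀ r, δ < T t0 r := by
      intro r
      have := e1 r
      rw [Matrix.sub_apply] at this
      linarith [hw t0 r]
    have e3 : ∀ s r, (q - T) s r ≤ δ := by
      intro s r
      by_contra hh; push Not at hh
      nlinarith [key t0 s r, e2 s]
    have := wtb _ e3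
    rw [wt_sub, g.wt_q] at this
    exact this

end functionals2
end FP

namespace FP

section assembly
open scoped Classical

noncomputable def avg (n : ℕ) (g : ℕ → ℝ) : ℝ := (∑ j ∈ Finset.range (2 ^ n), g j) / 2 ^ n

lemma frac_eq_avg (n : ℕ) (P : ℕ → Prop) [DecidablePred P] :
    frac n P = avg n (fun j => if P j then 1 else 0) := by
  unfold frac avg
  rw [Finset.sum_boole]

lemma avg_mono {n : ℕ} {f g : ℕ → ℝ} (h : ∀ j, j < 2 ^ n → f j ≤ g j) : avg n f ≤ avg n g := by
  unfold avg
  gcongr with j hj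
  exact h j (Finset.mem_range.1 hj)

lemma avg_add (n : ℕ) (f g : ℕ → ℝ) : avg n (fun j => f j + g j) = avg n f + avg n g := by
  unfold avg; rw [Finset.sum_add_distrib, add_div]

lemma avg_mul (n : ℕ) (c : ℝ) (g : ℕ → ℝ) : avg n (fun j => c * g j) = c * avg n g := by
  unfold avg; rw [← Finset.mul_sum, mul_div_assoc]

lemma avg_const (n : ℕ) (c : ℝ) : avg n (fun _ => c) = c := by
  unfold avg; simp

lemma avg_succ (n : ℕ) (g : ℕ → ℝ) :
    avg (n + 1) g = avg n (fun j => (g (2 * j) + g (2 * j + 1)) / 2) := by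
  unfold avg; rw [sum_range_two_pow_succ, ← Finset.sum_div, pow_succ]; field_simp

lemma frac_mono {n : ℕ} {P R : ℕ → Prop} [DecidablePred P] [DecidablePred R]
    (h : ∀ j, j < 2 ^ n → P j → R j) : frac n P ≤ frac n R := by
  rw [frac_eq_avg, frac_eq_avg]
  apply avg_mono
  intro j hj
  by_cases hP : P j
  · simp [hP, h j hj hP]
  · simp only [hP, if_false]; split_ifs <;> norm_num

lemma frac_add_le {n : ℕ} {P R : ℕ → Prop} [DecidablePred P] [DecidablePred R]
    (h : ∀ j, j < 2 ^ n → P j → ¬ R j) : frac n P + frac n R ≤ 1 := by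
  rw [frac_eq_avg, frac_eq_avg, ← avg_add]
  refine (avg_mono (g := fun _ => 1) ?_).trans_eq (avg_const _ _)
  intro j hj
  by_cases hP : P j
  · simp [hP, h j hj hP]
  · simp only [hP, if_false]; split_ifs <;> norm_num

variable (E H Z K : ℕ → ℕ → ℝ)

lemma polar_E (hE0 : ∀ n j, j < 2 ^ n → 0 ≤ E n j) (hE1 : ∀ n j, j < 2 ^ n → E n j ≤ 1)
    (hpm : ∀ n j, j < 2 ^ n → 2 * E n j ≤ E (n + 1) (2 * j) + E (n + 1) (2 * j + 1)) :
    Tendsto (fun n => avg n (fun j => (E (n + 1) (2 * j) - E n j) ^ 2)) atTop (𝓝 0) := by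
  set a := fun n => avg n (fun j => E n j ^ 2) with ha
  have hd : ∀ n, avg n (fun j => (E (n + 1) (2 * j) - E n j) ^ 2) ≤ 2 * (a (n + 1) - a n) := by
    intro n
    have : avg n (fun j => 1/2 * (E (n + 1) (2 * j) - E n j) ^ 2 + E n j ^ 2) ≤ a (n + 1) := by
      simp only [ha]; rw [avg_succ]
      apply avg_mono
      intro j hj
      have h1 := hpm n j hj
      have h2 := hE0 n j hj
      nlinarith [sq_nonneg (E (n + 1) (2 * j + 1) - E n j), mul_nonneg h2 (sub_nonneg.2 h1)]
    rw [avg_add, avg_mul] at this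
    simp only [ha] at this ⊢
    linarith
  have hn : ∀ n, 0 ≤ avg n (fun j => (E (n + 1) (2 * j) - E n j) ^ 2) := by
    intro n; unfold avg; positivity
  have hmono : Monotone a := monotone_nat_of_le_succ fun n => by linarith [hd n, hn n]
  have hb : BddAbove (Set.range a) := by
    refine ⟨1, ?_⟩
    rintro _ ⟨n, rfl⟩
    refine (avg_mono (g := fun _ => 1) ?_).trans_eq (avg_const _ _)
    intro j hj
    exact pow_le_one₀ (hE0 n j hj) (hE1 n j hj)
  have ht := tendsto_atTop_ciSup hmono hb
  have ht' : Tendsto (fun n => 2 * (a (n + 1) - a n)) atTop (𝓝 (2 * ((⨆ i, a i) - ⨆ i, a i))) :=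
    (((tendsto_add_atTop_iff_nat 1).2 ht).sub ht).const_mul 2
  rw [sub_self, mul_zero] at ht'
  exact squeeze_zero hn hd ht'

lemma bad_tendsto (hE0 : ∀ n j, j < 2 ^ n → 0 ≤ E n j) (hE1 : ∀ n j, j < 2 ^ n → E n j ≤ 1)
    (hpm : ∀ n j, j < 2 ^ n → 2 * E n j ≤ E (n + 1) (2 * j) + E (n + 1) (2 * j + 1))
    (hdich : ∀ ε > 0, ∃ η > 0, ∀ᶠ n in atTop, ∀ j, j < 2 ^ n → E (n + 1) (2 * j) - E n j ≤ η →
      K n j ≤ ε ∨ E n j ≤ ε)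
    (hEH : ∀ n j, j < 2 ^ n → E n j ≤ H n j)
    (hZ0 : ∀ n j, 0 ≤ Z n j)
    (hZH : ∀ n j, j < 2 ^ n → Z n j ^ 2 ≤ 2 * H n j)
    (C : ℝ) (hC : ∀ n, ∑ j ∈ Finset.range (2 ^ n), (H n j - E n j) ≤ C)
    (ε : ℝ) (hε : 0 < ε) :
    Tendsto (fun n => frac n (fun j => ¬ K n j ≤ ε ∧ ¬ Z n j ≤ ε)) atTop (𝓝 0) := by
  set ε' := min ε (ε ^ 2 / 4) with hε'
  have hε'0 : 0 < ε' := by positivity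
  obtain ⟨η, hη, hev⟩ := hdich ε' hε'0
  have t1 := (polar_E E hE0 hE1 hpm).const_mul (η ^ 2)⁻¹
  have t2 : Tendsto (fun n : ℕ => C / ε' * ((1/2 : ℝ)) ^ n) atTop (𝓝 (C / ε' * 0)) :=
    (tendsto_pow_atTop_nhds_zero_of_lt_one (by norm_num) (by norm_num)).const_mul _
  have t3 := t1.add t2
  simp only [mul_zero, add_zero] at t3
  refine squeeze_zero' (Eventually.of_forall fun n => ?_) ?_ t3
  · unfold frac; positivity
  · filter_upwards [hev] with n hn
    have hCn : avg n (fun j => H n j - E n j) ≤ C * (1/2 : ℝ) ^ n := by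
      unfold avg
      rw [one_div, inv_pow, ← div_eq_mul_inv]
      gcongr
      exact hC n
    calc _ ≤ avg n (fun j => (η ^ 2)⁻¹ * (E (n + 1) (2 * j) - E n j) ^ 2 + (ε')⁻¹ * (H n j - E n j)) := by
          rw [frac_eq_avg]
          apply avg_mono
          intro j hj
          have p1 : 0 ≤ (η ^ 2)⁻¹ * (E (n + 1) (2 * j) - E n j) ^ 2 := by positivity
          have p2 : 0 ≤ (ε')⁻¹ * (H n j - E n j) :=
            mul_nonneg (by positivity) (sub_nonneg.2 (hEH n j hj))
          split_ifs with hc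
          · by_cases h1 : E (n + 1) (2 * j) - E n j ≤ η
            · have hK : ¬ K n j ≤ ε' := fun h => hc.1 (h.trans (min_le_left _ _))
              have hEs := (hn j hj h1).resolve_left hK
              have hHb : ε ^ 2 / 2 < H n j := by
                have := hZH n j hj
                have h3 := not_le.1 hc.2
                nlinarith
              have : ε' ≤ H n j - E n j := by
                have := min_le_right ε (ε ^ 2 / 4)
                linarith
              have : 1 ≤ (ε')⁻¹ * (H n j - E n j) := by
                rw [inv_mul_eq_div, le_div_iff₀ hε'0]; linarith
              linarith
            · have : 1 ≤ (η ^ 2)⁻¹ * (E (n + 1) (2 * j) - E n j) ^ 2 := by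
                rw [inv_mul_eq_div, le_div_iff₀ (by positivity), one_mul]
                exact pow_le_pow_left₀ hη.le (not_le.1 h1).le 2
              linarith
          · linarith
      _ = (η ^ 2)⁻¹ * avg n (fun j => (E (n + 1) (2 * j) - E n j) ^ 2) + (ε')⁻¹ * avg n (fun j => H n j - E n j) := by
          rw [avg_add, avg_mul, avg_mul]
      _ ≤ _ := by
          have := mul_le_mul_of_nonneg_left hCn (inv_nonneg.2 hε'0.le)
          have e : C / ε' * (1/2:ℝ) ^ n = (ε')⁻¹ * (C * (1/2:ℝ) ^ n) := by ring
          rw [e]; linarith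

lemma fast_low (z : ℕ → ℕ → ℝ) (hz0 : ∀ n j, 0 ≤ z n j) (κ : ℝ) (hκ : 2 ≤ κ)
    (hrec : ∀ n j, j < 2 ^ n →
      (z (n + 1) (2 * j) ≤ κ * z n j ∧ z (n + 1) (2 * j + 1) ≤ κ * z n j ^ 2) ∨
      (z (n + 1) (2 * j + 1) ≤ κ * z n j ∧ z (n + 1) (2 * j) ≤ κ * z n j ^ 2))
    (x : ℝ) (hx : x ≤ 1) (hfr : ∀ η > 0, ∀ δ > 0, ∃ m, x - δ ≤ frac m (fun j => z m j ≤ η))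
    (β : ℝ) (hβ0 : 0 < β) (hβ : β < 1 / 2) (δ : ℝ) (hδ : 0 < δ) :
    ∀ᶠ n in atTop, x - δ ≤ frac n (fun j => z n j < (2:ℝ) ^ (-(((2 ^ n : ℕ) : ℝ) ^ β))) := by
  set d := min (δ / 4) (1 / 2) with hd
  have hd0 : 0 < d := by positivity
  have hd1 : d ≤ 1 / 2 := min_le_right _ _
  have hd2 : d ≤ δ / 4 := min_le_left _ _
  obtain ⟨η, hη, h⟩ := fast_abstract z hz0 κ hκ hrec β hβ0 hβ d hd0 (by linarith)
  obtain ⟨m, hm⟩ := hfr η hη d hd0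
  filter_upwards [h m] with n hn
  refine le_trans ?_ hn
  nlinarith

lemma thr_sum (β : ℝ) : ∀ᶠ n : ℕ in atTop,
    (2:ℝ) ^ (-(((2 ^ n : ℕ) : ℝ) ^ (1/4 : ℝ))) + (2:ℝ) ^ (-(((2 ^ n : ℕ) : ℝ) ^ β)) ≤ 1 := by
  -- reduce to negative exponent
  set b := min β (-1) with hb
  have hbn : b ≤ -1 := min_le_right _ _
  have hN : Tendsto (fun n : ℕ => ((2 ^ n : ℕ) : ℝ)) atTop atTop := by
    push_cast
    exact tendsto_pow_atTop_atTop_of_one_lt (by norm_num)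
  have hlim : Tendsto (fun y : ℝ => y ^ (-(4 * b)) * Real.exp (-(Real.log 2) * y)) atTop (𝓝 0) :=
    tendsto_rpow_mul_exp_neg_mul_atTop_nhds_zero _ _ (Real.log_pos (by norm_num))
  have hy : Tendsto (fun n : ℕ => ((2 ^ n : ℕ) : ℝ) ^ (1/4 : ℝ)) atTop atTop :=
    (tendsto_rpow_atTop (by norm_num)).comp hN
  have hev := (hlim.comp hy).eventually (gt_mem_nhds (show (0:ℝ) < 1/2 by norm_num))
  filter_upwards [hev] with n hn
  set N : ℝ := ((2 ^ n : ℕ) : ℝ) with hNdef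
  have hN1 : 1 ≤ N := by rw [hNdef]; exact_mod_cast Nat.one_le_two_pow
  have hN0 : 0 < N := by linarith
  simp only [Function.comp] at hn
  rw [← Real.rpow_mul hN0.le, show (1/4 : ℝ) * (-(4 * b)) = -b by ring, Real.rpow_neg hN0.le,
    neg_mul, ← mul_neg, Real.exp_mul, Real.exp_log (by norm_num)] at hn
  set x := N ^ b with hx
  have hx0 : 0 < x := by positivity
  have hx1 : x ≤ 1 := Real.rpow_le_one_of_one_le_of_nonpos hN1 (by linarith)
  have h1 : (2:ℝ) ^ (-(N ^ β)) ≤ (2:ℝ) ^ (-x) := by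
    apply Real.rpow_le_rpow_of_exponent_le (by norm_num)
    apply neg_le_neg
    exact Real.rpow_le_rpow_of_exponent_le hN1 (min_le_left _ _)
  have h2 : (2:ℝ) ^ (-x) ≤ 1 - x / 2 := by
    have := rpow_one_add_le_one_add_mul_self (s := -(1/2)) (by norm_num) hx0.le hx1
    rw [Real.rpow_neg (by norm_num), ← Real.inv_rpow (by norm_num)]
    norm_num at this ⊢
    linarith
  have h3 : (2:ℝ) ^ (-(N ^ (1/4:ℝ))) < x / 2 := by
    rw [inv_mul_eq_div, div_lt_iff₀ hx0] at hn
    linarith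
  linarith

theorem assembly (κ : ℝ) (hκ : 2 ≤ κ) (C L : ℝ)
    (hE0 : ∀ n j, j < 2 ^ n → 0 ≤ E n j)
    (hpm : ∀ n j, j < 2 ^ n → 2 * E n j ≤ E (n + 1) (2 * j) + E (n + 1) (2 * j + 1))
    (hdich : ∀ ε > 0, ∃ η > 0, ∀ᶠ n in atTop, ∀ j, j < 2 ^ n → E (n + 1) (2 * j) - E n j ≤ η →
      K n j ≤ ε ∨ E n j ≤ ε)
    (hEH : ∀ n j, j < 2 ^ n → E n j ≤ H n j)
    (hHl : ∀ n j, j < 2 ^ n → H n j ≤ Real.log 2)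
    (hZ0 : ∀ n j, 0 ≤ Z n j) (hK0 : ∀ n j, 0 ≤ K n j)
    (hHZ : ∀ n j, j < 2 ^ n → H n j ≤ Z n j)
    (hZH : ∀ n j, j < 2 ^ n → Z n j ^ 2 ≤ 2 * H n j)
    (hKH : ∀ n j, j < 2 ^ n → Real.log 2 - H n j ≤ K n j)
    (hKZ : ∀ n j, j < 2 ^ n → 1 - K n j ≤ Z n j)
    (hC : ∀ n, ∑ j ∈ Finset.range (2 ^ n), (H n j - E n j) ≤ C)
    (hL : Tendsto (fun n => avg n (H n)) atTop (𝓝 (Real.log 2 * L)))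
    (hZr : ∀ n j, j < 2 ^ n → Z (n + 1) (2 * j) ≤ κ * Z n j ∧ Z (n + 1) (2 * j + 1) ≤ κ * Z n j ^ 2)
    (hKr : ∀ n j, j < 2 ^ n → K (n + 1) (2 * j + 1) ≤ κ * K n j ∧ K (n + 1) (2 * j) ≤ κ * K n j ^ 2)
    (β : ℝ) (hβ : β < 1 / 2) :
    Tendsto (fun n => frac n (fun j => Z n j < (2:ℝ) ^ (-(((2 ^ n : ℕ) : ℝ) ^ β)))) atTop
      (𝓝 (1 - L)) := by
  have hl2 : 0 < Real.log 2 := Real.log_pos (by norm_num)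
  have hl1 : Real.log 2 ≤ 1 := by linarith [Real.log_two_lt_d9]
  have hL0 : 0 ≤ L := by
    have : 0 ≤ Real.log 2 * L := ge_of_tendsto' hL fun n => by
      refine (avg_const n 0).symm.trans_le (avg_mono fun j hj => (hE0 n j hj).trans (hEH n j hj))
    exact nonneg_of_mul_nonneg_right this hl2
  have hL1 : L ≤ 1 := by
    have : Real.log 2 * L ≤ Real.log 2 := le_of_tendsto' hL fun n =>
      (avg_mono fun j hj => hHl n j hj).trans_eq (avg_const n _)
    by_contra h
    nlinarith
  have hbad := bad_tendsto E H Z K hE0 (fun n j hj => (hEH n j hj).trans ((hHl n j hj).trans hl1)) hpm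
    hdich hEH hZ0 hZH C hC
  -- counting
  have cover : ∀ n η, 1 ≤ frac n (fun j => Z n j ≤ η) + frac n (fun j => K n j ≤ η) +
      frac n (fun j => ¬ K n j ≤ η ∧ ¬ Z n j ≤ η) := by
    intro n η
    rw [frac_eq_avg, frac_eq_avg, frac_eq_avg, ← avg_add, ← avg_add]
    refine (avg_const n 1).symm.trans_le (avg_mono fun j hj => ?_)
    by_cases h1 : Z n j ≤ η <;> by_cases h2 : K n j ≤ η <;> simp [h1, h2]
  have upZ : ∀ n η, 0 ≤ η → avg n (H n) + Real.log 2 * frac n (fun j => Z n j ≤ η) ≤ Real.log 2 + η := by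
    intro n η hη
    rw [frac_eq_avg, ← avg_mul, ← avg_add]
    refine (avg_mono fun j hj => ?_).trans_eq (avg_const n _)
    by_cases h1 : Z n j ≤ η
    · simp only [h1, if_true]; linarith [hHZ n j hj]
    · simp only [h1, if_false]; linarith [hHl n j hj]
  have upK : ∀ n η, 0 ≤ η → Real.log 2 * frac n (fun j => K n j ≤ η) ≤ avg n (H n) + η := by
    intro n η hη
    rw [frac_eq_avg, ← avg_mul, ← avg_const n η, ← avg_add, avg_const]
    refine avg_mono fun j hj => ?_
    by_cases h1 : K n j ≤ η
    · simp only [h1, if_true]; linarith [hKH n j hj]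
    · simp only [h1, if_false]; linarith [hE0 n j hj, hEH n j hj]
  have base : ∀ η > 0, ∀ δ > 0, ∃ m, 1 - L - δ ≤ frac m (fun j => Z m j ≤ η) ∧
      L - δ ≤ frac m (fun j => K m j ≤ η) := by
    intro η hη δ hδ
    set e := min η (Real.log 2 * δ / 4) with he
    have he0 : 0 < e := by positivity
    have he1 : e ≤ Real.log 2 * δ / 4 := min_le_right _ _
    have ev1 := (hbad e he0).eventually (gt_mem_nhds (show (0:ℝ) < δ / 4 by positivity))
    have ev2 := hL.eventually (Metric.ball_mem_nhds _ (show 0 < Real.log 2 * δ / 4 by positivity))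
    obtain ⟨m, hm1, hm2⟩ := (ev1.and ev2).exists
    have hm2' : |avg m (H m) - Real.log 2 * L| < Real.log 2 * δ / 4 := hm2
    rw [abs_lt] at hm2'
    have c1 := cover m e
    have c2 := upZ m e he0.le
    have c3 := upK m e he0.le
    have m1 : frac m (fun j => Z m j ≤ e) ≤ frac m (fun j => Z m j ≤ η) :=
      frac_mono fun j _ h => h.trans (min_le_left _ _)
    have m2 : frac m (fun j => K m j ≤ e) ≤ frac m (fun j => K m j ≤ η) :=
      frac_mono fun j _ h => h.trans (min_le_left _ _)
    have c2' : frac m (fun j => Z m j ≤ e) ≤ 1 - L + δ / 2 := by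
      by_contra h
      push Not at h
      nlinarith
    have c3' : frac m (fun j => K m j ≤ e) ≤ L + δ / 2 := by
      by_contra h
      push Not at h
      nlinarith
    exact ⟨m, by linarith, by linarith⟩
  set b1 := max β (1/4) with hb1
  have lowZ := fast_low Z hZ0 κ hκ (fun n j hj => Or.inl (hZr n j hj)) (1 - L) (by linarith)
    (fun η hη δ hδ => (base η hη δ hδ).imp fun m h => h.1) b1 (lt_max_of_lt_right (by norm_num))
    (max_lt hβ (by norm_num))
  have lowK := fast_low K hK0 κ hκ (fun n j hj => Or.inr (hKr n j hj)) L hL1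
    (fun η hη δ hδ => (base η hη δ hδ).imp fun m h => h.2) (1/4) (by norm_num) (by norm_num)
  rw [Metric.tendsto_nhds]
  intro δ hδ
  filter_upwards [lowZ (δ / 2) (by positivity), lowK (δ / 2) (by positivity), thr_sum β] with n h1 h2 h3
  have hN1 : (1:ℝ) ≤ ((2 ^ n : ℕ) : ℝ) := by exact_mod_cast Nat.one_le_two_pow
  have m1 : frac n (fun j => Z n j < (2:ℝ) ^ (-(((2 ^ n : ℕ) : ℝ) ^ b1))) ≤
      frac n (fun j => Z n j < (2:ℝ) ^ (-(((2 ^ n : ℕ) : ℝ) ^ β))) := by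
    refine frac_mono fun j _ h => h.trans_le ?_
    apply Real.rpow_le_rpow_of_exponent_le (by norm_num)
    apply neg_le_neg
    exact Real.rpow_le_rpow_of_exponent_le hN1 (le_max_left _ _)
  have m2 := frac_add_le (n := n) (P := fun j => Z n j < (2:ℝ) ^ (-(((2 ^ n : ℕ) : ℝ) ^ β)))
    (R := fun j => K n j < (2:ℝ) ^ (-(((2 ^ n : ℕ) : ℝ) ^ (1/4 : ℝ)))) (by
      intro j hj h4 h5
      have := hKZ n j hj
      linarith)
  rw [Real.dist_eq, abs_lt]
  constructor <;> linarith

end assembly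
end FP

namespace FP

section markov
variable {S : Type*} [Fintype S] [DecidableEq S] {Q : Matrix S S ℝ}

lemma pow_nonneg' (hQ0 : ∀ s t, 0 ≤ Q s t) (k : ℕ) : ∀ s t, 0 ≤ (Q ^ k) s t := by
  induction k with
  | zero => intro s t; rw [pow_zero, Matrix.one_apply]; split_ifs <;> norm_num
  | succ k ih =>
    intro s t
    rw [pow_succ, Matrix.mul_apply]
    exact Finset.sum_nonneg fun r _ => mul_nonneg (ih s r) (hQ0 r t)

lemma pow_row (hQ1 : ∀ s, ∑ t, Q s t = 1) (k : ℕ) : ∀ s, ∑ t, (Q ^ k) s t = 1 := by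
  induction k with
  | zero => intro s; simp [Matrix.one_apply]
  | succ k ih =>
    intro s
    simp only [pow_succ, Matrix.mul_apply]
    rw [Finset.sum_comm]
    simp only [← Finset.mul_sum, hQ1, mul_one, ih]

lemma pow_stat {μ : S → ℝ} (h : ∀ t, ∑ s, μ s * Q s t = μ t) (k : ℕ) :
    ∀ t, ∑ s, μ s * (Q ^ k) s t = μ t := by
  induction k with
  | zero => intro s; simp [Matrix.one_apply]
  | succ k ih =>
    intro t
    simp only [pow_succ, Matrix.mul_apply, Finset.mul_sum]
    rw [Finset.sum_comm]
    simp only [← mul_assoc, ← Finset.sum_mul, ih, h]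

lemma mu_pos (hQ0 : ∀ s t, 0 ≤ Q s t) (hirr : ∀ s t, ∃ k, 1 ≤ k ∧ 0 < (Q ^ k) s t)
    {μ : S → ℝ} (hμ0 : ∀ s, 0 ≤ μ s) (hμ1 : ∑ s, μ s = 1) (h : ∀ t, ∑ s, μ s * Q s t = μ t) (t : S) :
    0 < μ t := by
  have : ∃ s, 0 < μ s := by
    by_contra hh
    push Not at hh
    have : ∑ s, μ s ≤ 0 := Finset.sum_nonpos fun s _ => hh s
    linarith
  obtain ⟨s, hs⟩ := this
  obtain ⟨k, -, hk⟩ := hirr s t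
  rw [← pow_stat h k t]
  exact Finset.sum_pos' (fun r _ => mul_nonneg (hμ0 r) (pow_nonneg' hQ0 k r t))
    ⟨s, Finset.mem_univ _, mul_pos hs hk⟩

lemma pow_pos_add (hQ0 : ∀ s t, 0 ≤ Q s t) {a b : ℕ} {s t r : S} (h1 : 0 < (Q ^ a) s t)
    (h2 : 0 < (Q ^ b) t r) : 0 < (Q ^ (a + b)) s r := by
  rw [pow_add, Matrix.mul_apply]
  exact Finset.sum_pos' (fun x _ => mul_nonneg (pow_nonneg' hQ0 a s x) (pow_nonneg' hQ0 b x r))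
    ⟨t, Finset.mem_univ _, mul_pos h1 h2⟩

lemma exists_w [Nonempty S] (hQ0 : ∀ s t, 0 ≤ Q s t) (hQ1 : ∀ s, ∑ t, Q s t = 1)
    (hirr : ∀ s t, ∃ k, 1 ≤ k ∧ 0 < (Q ^ k) s t)
    (haper : ∀ s : S, ∀ d : ℕ, (∀ k, 1 ≤ k → 0 < (Q ^ k) s s → d ∣ k) → d = 1) :
    ∃ w : ℝ, 0 < w ∧ ∃ k0 : ℕ, ∀ k, k0 ≤ k → ∀ s t, w ≤ (Q ^ k) s t := by
  have h1 : ∀ s, ∃ n, ∀ m, n ≤ m → 0 < (Q ^ m) s s := by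
    intro s
    let R : Set ℕ := {k | 1 ≤ k ∧ 0 < (Q ^ k) s s}
    have hg : Nat.setGcd R = 1 := haper s _ fun k hk hp => Nat.setGcd_dvd_of_mem ⟨hk, hp⟩
    obtain ⟨n, hn⟩ := Nat.exists_mem_closure_of_ge R
    refine ⟨n, fun m hm => ?_⟩
    have hmem := hn m hm (by rw [hg]; exact one_dvd m)
    refine AddSubmonoid.closure_induction (motive := fun x _ => 0 < (Q ^ x) s s) ?_ ?_ ?_ hmem
    · intro x hx; exact hx.2
    · simp
    · intro x y _ _ hx hy; exact pow_pos_add hQ0 hx hy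
  choose n hn using h1
  choose k hk1 hk using hirr
  let k0 := (∑ s, n s) + ∑ s, ∑ t, k s t
  have hpos : ∀ s t, 0 < (Q ^ k0) s t := by
    intro s t
    have e1 : n s ≤ ∑ s, n s := Finset.single_le_sum (fun _ _ => Nat.zero_le _) (Finset.mem_univ s)
    have e2 : k s t ≤ ∑ t, k s t :=
      Finset.single_le_sum (f := fun t => k s t) (fun _ _ => Nat.zero_le _) (Finset.mem_univ t)
    have e3 : ∑ t, k s t ≤ ∑ s, ∑ t, k s t :=
      Finset.single_le_sum (f := fun s => ∑ t, k s t) (fun _ _ => Nat.zero_le _) (Finset.mem_univ s)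
    have : k0 = (k0 - k s t) + k s t := by omega
    rw [this]
    exact pow_pos_add hQ0 (hn s _ (by omega)) (hk s t)
  clear_value k0
  obtain ⟨p, hp⟩ := Finite.exists_min (fun p : S × S => (Q ^ k0) p.1 p.2)
  refine ⟨(Q ^ k0) p.1 p.2, hpos _ _, k0, fun m hm s t => ?_⟩
  obtain ⟨j, rfl⟩ := Nat.exists_eq_add_of_le' hm
  rw [pow_add, Matrix.mul_apply]
  calc (Q ^ k0) p.1 p.2 = ∑ r, (Q ^ j) s r * (Q ^ k0) p.1 p.2 := by
        rw [← Finset.sum_mul, pow_row hQ1, one_mul]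
    _ ≤ _ := Finset.sum_le_sum fun r _ => mul_le_mul_of_nonneg_left (hp (r, t)) (pow_nonneg' hQ0 j s r)

end markov
end FP

namespace FP

section partition
open scoped Classical

variable {Ω V V' M : Type*} [Fintype Ω] [Fintype V] [Fintype V']

lemma sum_blocks (B : Ω → V) (G : Finset Ω → ℝ) (hG : G ∅ = 0) :
    ∑ v, G (Finset.univ.filter fun ω => B ω = v) =
      ∑ c ∈ Finset.univ.image (fun ω => Finset.univ.filter fun ω' => B ω' = B ω), G c := by
  have h1 : Finset.univ.image (fun ω => Finset.univ.filter fun ω' => B ω' = B ω) =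
      (Finset.univ.image B).image (fun v => Finset.univ.filter fun ω => B ω = v) := by
    rw [Finset.image_image]; rfl
  rw [h1, Finset.sum_image]
  · symm
    apply Finset.sum_subset (Finset.subset_univ _)
    intro v _ hv
    rw [Finset.filter_false_of_mem, hG]
    intro ω _ h
    exact hv (Finset.mem_image.2 ⟨ω, Finset.mem_univ _, h⟩)
  · intro v hv v' hv' h
    obtain ⟨ω, -, rfl⟩ := Finset.mem_image.1 hv
    have : ω ∈ Finset.univ.filter fun ω' => B ω' = v' := by
      have h' : (Finset.univ.filter fun ω' => B ω' = B ω) = Finset.univ.filter fun ω' => B ω' = v' := h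
      rw [← h']; simp
    simpa using this

lemma sum_blocks_congr (B : Ω → V) (B' : Ω → V') (hB : ∀ ω ω', B ω = B ω' ↔ B' ω = B' ω')
    (G : Finset Ω → ℝ) (hG : G ∅ = 0) :
    ∑ v, G (Finset.univ.filter fun ω => B ω = v) = ∑ v, G (Finset.univ.filter fun ω => B' ω = v) := by
  rw [sum_blocks B G hG, sum_blocks B' G hG]
  simp only [hB]

variable [AddCommMonoid M]

/-- weights of the event `u = b`, `B = v` -/
noncomputable def ff (A : Ω → M) (u : Ω → ZMod 2) (B : Ω → V) (b : ZMod 2) (v : V) : M :=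
  ∑ ω, if u ω = b ∧ B ω = v then A ω else 0

noncomputable def gg (A : Ω → M) (B : Ω → V) (v : V) : M := ∑ ω, if B ω = v then A ω else 0

noncomputable def Phi (φ : M → M → ℝ) (A : Ω → M) (u : Ω → ZMod 2) (B : Ω → V) : ℝ :=
  ∑ v, φ (ff A u B 0 v) (ff A u B 1 v)

noncomputable def Psi (ψ : M → ℝ) (A : Ω → M) (B : Ω → V) : ℝ := ∑ v, ψ (gg A B v)

lemma Phi_congr {φ : M → M → ℝ} (hφ : φ 0 0 = 0) (A : Ω → M) (u : Ω → ZMod 2) (B : Ω → V) (B' : Ω → V')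
    (hB : ∀ ω ω', B ω = B ω' ↔ B' ω = B' ω') : Phi φ A u B = Phi φ A u B' := by
  have := sum_blocks_congr B B' hB (fun c => φ (∑ ω ∈ c, if u ω = 0 then A ω else 0)
    (∑ ω ∈ c, if u ω = 1 then A ω else 0)) (by simpa using hφ)
  simpa only [Phi, ff, Finset.sum_filter, ← ite_and, and_comm] using this

lemma Psi_congr {ψ : M → ℝ} (hψ : ψ 0 = 0) (A : Ω → M) (B : Ω → V) (B' : Ω → V')
    (hB : ∀ ω ω', B ω = B ω' ↔ B' ω = B' ω') : Psi ψ A B = Psi ψ A B' := by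
  have := sum_blocks_congr B B' hB (fun c => ψ (∑ ω ∈ c, A ω)) (by simpa using hψ)
  simpa only [Psi, gg, Finset.sum_filter] using this

lemma Phi_equiv {Ω' : Type*} [Fintype Ω'] (e : Ω ≃ Ω') (φ : M → M → ℝ) (A : Ω' → M) (u : Ω' → ZMod 2)
    (B : Ω' → V) : Phi φ (fun ω => A (e ω)) (fun ω => u (e ω)) (fun ω => B (e ω)) = Phi φ A u B := by
  unfold Phi ff
  refine Finset.sum_congr rfl fun v _ => ?_
  rw [e.sum_comp (fun ω => if u ω = 0 ∧ B ω = v then A ω else 0),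
    e.sum_comp (fun ω => if u ω = 1 ∧ B ω = v then A ω else 0)]

lemma zmod2_cases (a : ZMod 2) : a = 0 ∨ a = 1 := by
  revert a; decide

lemma zmod2_univ : (Finset.univ : Finset (ZMod 2)) = {0, 1} := by decide

lemma sum_zmod2 {R : Type*} [AddCommMonoid R] (f : ZMod 2 → R) : ∑ a, f a = f 0 + f 1 := by
  rw [zmod2_univ, Finset.sum_pair (by decide)]

lemma ff_add (A : Ω → M) (u : Ω → ZMod 2) (B : Ω → V) (v : V) :
    ff A u B 0 v + ff A u B 1 v = gg A B v := by
  unfold ff gg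
  rw [← Finset.sum_add_distrib]
  refine Finset.sum_congr rfl fun ω _ => ?_
  rcases zmod2_cases (u ω) with h | h <;> simp [h]

lemma gg_pair (A : Ω → M) (u : Ω → ZMod 2) (B : Ω → V) (b : ZMod 2) (v : V) :
    gg A (fun ω => (u ω, B ω)) (b, v) = ff A u B b v := by
  unfold ff gg
  refine Finset.sum_congr rfl fun ω _ => ?_
  simp only [Prod.mk.injEq]

lemma sum_gg (A : Ω → M) (B : Ω → V) : ∑ v, gg A B v = ∑ ω, A ω := by
  unfold gg
  rw [Finset.sum_comm]
  simp

lemma chain (φ : M → M → ℝ) (ψ : M → ℝ) (h : ∀ a b, φ a b = ψ a + ψ b - ψ (a + b))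
    (A : Ω → M) (u : Ω → ZMod 2) (B : Ω → V) :
    Phi φ A u B = Psi ψ A (fun ω => (u ω, B ω)) - Psi ψ A B := by
  unfold Phi Psi
  rw [Fintype.sum_prod_type, sum_zmod2, ← Finset.sum_add_distrib, ← Finset.sum_sub_distrib]
  refine Finset.sum_congr rfl fun v _ => ?_
  rw [h, gg_pair, gg_pair, ff_add]

end partition

section product
open scoped Classical
variable {Ω V R : Type*} [Fintype Ω] [Fintype V] [Semiring R]

lemma ff_mul (A : Ω → R) (u : Ω → ZMod 2) (B : Ω → V) (b b' : ZMod 2) (v v' : V) :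
    ff A u B b v * ff A u B b' v' = ∑ p : Ω × Ω,
      if (u p.1 = b ∧ B p.1 = v) ∧ (u p.2 = b' ∧ B p.2 = v') then A p.1 * A p.2 else 0 := by
  unfold ff
  rw [Finset.sum_mul_sum, Fintype.sum_prod_type]
  refine Finset.sum_congr rfl fun ω _ => Finset.sum_congr rfl fun ω' _ => ?_
  rw [ite_zero_mul_ite_zero]

lemma Phi_minus (φ : R → R → ℝ) (A : Ω → R) (u : Ω → ZMod 2) (B : Ω → V) :
    Phi φ (fun p : Ω × Ω => A p.1 * A p.2) (fun p => u p.1 + u p.2) (fun p => (B p.1, B p.2)) =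
    ∑ v, ∑ v', φ (ff A u B 0 v * ff A u B 0 v' + ff A u B 1 v * ff A u B 1 v')
      (ff A u B 1 v * ff A u B 0 v' + ff A u B 0 v * ff A u B 1 v') := by
  unfold Phi
  rw [Fintype.sum_prod_type]
  refine Finset.sum_congr rfl fun v _ => Finset.sum_congr rfl fun v' _ => ?_
  rw [ff_mul, ff_mul, ff_mul, ff_mul, ← Finset.sum_add_distrib, ← Finset.sum_add_distrib]
  congr 1
  · unfold ff
    refine Finset.sum_congr rfl fun p _ => ?_
    by_cases h1 : B p.1 = v <;> by_cases h2 : B p.2 = v' <;>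
    rcases zmod2_cases (u p.1) with h | h <;> rcases zmod2_cases (u p.2) with h' | h' <;>
      simp [h, h', h1, h2, show (1:ZMod 2) + 1 = 0 by decide]
  · unfold ff
    refine Finset.sum_congr rfl fun p _ => ?_
    by_cases h1 : B p.1 = v <;> by_cases h2 : B p.2 = v' <;>
    rcases zmod2_cases (u p.1) with h | h <;> rcases zmod2_cases (u p.2) with h' | h' <;>
      simp [h, h', h1, h2, show (1:ZMod 2) + 1 = 0 by decide]

lemma Phi_plus (φ : R → R → ℝ) (A : Ω → R) (u : Ω → ZMod 2) (B : Ω → V) :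
    Phi φ (fun p : Ω × Ω => A p.1 * A p.2) (fun p => u p.2)
      (fun p => ((B p.1, B p.2), u p.1 + u p.2)) =
    ∑ v, ∑ v', (φ (ff A u B 0 v * ff A u B 0 v') (ff A u B 1 v * ff A u B 1 v') +
      φ (ff A u B 1 v * ff A u B 0 v') (ff A u B 0 v * ff A u B 1 v')) := by
  unfold Phi
  rw [Fintype.sum_prod_type, Fintype.sum_prod_type]
  refine Finset.sum_congr rfl fun v _ => Finset.sum_congr rfl fun v' _ => ?_
  rw [ff_mul, ff_mul, ff_mul, ff_mul, sum_zmod2]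
  unfold ff
  have hf : ∀ f g f' g' : Ω × Ω → R, (∀ p, f p = f' p) → (∀ p, g p = g' p) →
      φ (∑ p, f p) (∑ p, g p) = φ (∑ p, f' p) (∑ p, g' p) := by
    intro f g f' g' h1 h2; simp only [h1, h2]
  congr 1 <;> apply hf <;> intro p <;>
    by_cases h1 : B p.1 = v <;> by_cases h2 : B p.2 = v' <;>
    rcases zmod2_cases (u p.1) with h | h <;> rcases zmod2_cases (u p.2) with h' | h' <;>
      simp [h, h', h1, h2, show (1:ZMod 2) + 1 = 0 by decide]

end product

section ents
variable {S Ω V : Type*} [Fintype S] [Fintype Ω] [Fintype V]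

noncomputable def psH (μ : S → ℝ) (a : Matrix S S ℝ) : ℝ := Real.negMulLog (wt μ a)
noncomputable def psE (μ : S → ℝ) (a : Matrix S S ℝ) : ℝ := ∑ s, ∑ t, Real.negMulLog (μ s * a s t)

lemma fH_ps (μ : S → ℝ) (a b : Matrix S S ℝ) : fH μ a b = psH μ a + psH μ b - psH μ (a + b) := by
  unfold fH psH phi; rw [wt_add]

lemma fE_ps (μ : S → ℝ) (a b : Matrix S S ℝ) : fE μ a b = psE μ a + psE μ b - psE μ (a + b) := by
  unfold fE psE
  simp only [← phi_smul]
  simp only [phi, ← Finset.sum_add_distrib, ← Finset.sum_sub_distrib, Matrix.add_apply, mul_add]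

lemma psE_sub_psH (μ : S → ℝ) (a : Matrix S S ℝ) :
    psE μ a - psH μ a = ent (fun p : S × S => μ p.1 * a p.1 p.2) := by
  unfold psE psH ent wt
  rw [Fintype.sum_prod_type, Fintype.sum_prod_type]

lemma ent_nonneg {ι : Type*} [Fintype ι] (x : ι → ℝ) (hx : ∀ i, 0 ≤ x i) : 0 ≤ ent x := by
  unfold ent
  rw [sub_nonneg]
  have : Real.negMulLog (∑ i, x i) = ∑ i, (-(x i * Real.log (∑ i, x i))) := by
    rw [Real.negMulLog, Finset.sum_neg_distrib, ← Finset.sum_mul]; ring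
  rw [this]
  refine Finset.sum_le_sum fun i _ => ?_
  rcases (hx i).eq_or_lt with h | h
  · simp [← h]
  · have h1 : x i ≤ ∑ i, x i := Finset.single_le_sum (fun i _ => hx i) (Finset.mem_univ i)
    have := Real.log_le_log h h1
    rw [Real.negMulLog]
    nlinarith

lemma negMulLog_le_one {x : ℝ} (hx : 0 ≤ x) : Real.negMulLog x ≤ 1 := by
  have := neg_mul_log_le_sqrt hx
  nlinarith [sq_nonneg (Real.sqrt x - 1), Real.sq_sqrt hx]

lemma gg_nonneg {A : Ω → Matrix S S ℝ} (hA : ∀ ω s t, 0 ≤ A ω s t) (B : Ω → V) (v : V) (s t : S) :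
    0 ≤ gg A B v s t := by
  unfold gg
  rw [Matrix.sum_apply]
  exact Finset.sum_nonneg fun ω _ => by split_ifs <;> simp [hA]

lemma ff_nonneg {A : Ω → Matrix S S ℝ} (hA : ∀ ω s t, 0 ≤ A ω s t) (u : Ω → ZMod 2) (B : Ω → V)
    (b : ZMod 2) (v : V) (s t : S) : 0 ≤ ff A u B b v s t := by
  unfold ff
  rw [Matrix.sum_apply]
  exact Finset.sum_nonneg fun ω _ => by split_ifs <;> simp [hA]

lemma Psi_H_le_E {μ : S → ℝ} (hμ : ∀ s, 0 < μ s) {A : Ω → Matrix S S ℝ} (hA : ∀ ω s t, 0 ≤ A ω s t)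
    (B : Ω → V) : Psi (psH μ) A B ≤ Psi (psE μ) A B := by
  unfold Psi
  refine Finset.sum_le_sum fun v _ => ?_
  rw [← sub_nonneg, psE_sub_psH]
  exact ent_nonneg _ fun p => mul_nonneg (hμ _).le (gg_nonneg hA B v _ _)

lemma Psi_E_le {μ : S → ℝ} (hμ : ∀ s, 0 < μ s) {A : Ω → Matrix S S ℝ} (hA : ∀ ω s t, 0 ≤ A ω s t)
    (h1 : wt μ (∑ ω, A ω) = 1)
    (B : Ω → V) : Psi (psE μ) A B ≤ Psi (psH μ) A B + (Fintype.card (S × S) : ℝ) := by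
  have : Psi (psE μ) A B - Psi (psH μ) A B ≤ (Fintype.card (S × S) : ℝ) := by
    unfold Psi
    rw [← Finset.sum_sub_distrib]
    simp only [psE_sub_psH]
    refine (ent_superadd _ fun v p => mul_nonneg (hμ _).le (gg_nonneg hA B v _ _)).trans ?_
    have e : ∀ p : S × S, ∑ v, μ p.1 * gg A B v p.1 p.2 = μ p.1 * (∑ ω, A ω) p.1 p.2 := by
      intro p
      rw [← Finset.mul_sum, ← sum_gg A B, Matrix.sum_apply]
    simp only [e]
    rw [← psE_sub_psH]
    unfold psH psE
    rw [h1, Real.negMulLog_one, sub_zero]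
    have hn : ∀ s t, 0 ≤ (∑ ω, A ω) s t := by
      intro s t; rw [Matrix.sum_apply]; exact Finset.sum_nonneg fun ω _ => hA ω s t
    calc _ ≤ ∑ s : S, ∑ t : S, (1:ℝ) := Finset.sum_le_sum fun s _ => Finset.sum_le_sum fun t _ =>
          negMulLog_le_one (mul_nonneg (hμ s).le (hn s t))
      _ = _ := by simp
  linarith

end ents
end FP

namespace FP

section polar

lemma bit_even (j k : ℕ) : bitOf (2 * j) (k + 1) = bitOf j k := by
  unfold bitOf
  rw [Fin.mk.injEq, pow_succ', ← Nat.div_div_eq_div_mul, Nat.mul_div_cancel_left _ (by norm_num)]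

lemma bit_odd (j k : ℕ) : bitOf (2 * j + 1) (k + 1) = bitOf j k := by
  unfold bitOf
  rw [Fin.mk.injEq, pow_succ', ← Nat.div_div_eq_div_mul, show (2 * j + 1) / 2 = j by omega]

lemma bit_even0 (j : ℕ) : bitOf (2 * j) 0 = 0 := by
  unfold bitOf; ext; simp

lemma bit_odd0 (j : ℕ) : bitOf (2 * j + 1) 0 = 1 := by
  unfold bitOf; ext; simp

lemma bit_lo {n i : ℕ} (h : i < 2 ^ n) : bitOf i n = 0 := by
  unfold bitOf; ext; simp [Nat.div_eq_of_lt h]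

lemma bit_hi {n i : ℕ} (h : i < 2 ^ n) : bitOf (2 ^ n + i) n = 1 := by
  unfold bitOf; ext
  simp [Nat.add_div_left _ (Nat.two_pow_pos n), Nat.div_eq_of_lt h]

lemma bit_hi_lt {n m : ℕ} (i : ℕ) (h : m < n) : bitOf (2 ^ n + i) m = bitOf i m := by
  unfold bitOf
  obtain ⟨k, rfl⟩ := Nat.exists_eq_add_of_lt h
  rw [Fin.mk.injEq, show 2 ^ (m + k + 1) = 2 ^ m * (2 * 2 ^ k) by ring, Nat.mul_add_div (Nat.two_pow_pos m),
    Nat.mul_add_mod]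

def lo (n : ℕ) (i : Fin (2 ^ n)) : Fin (2 ^ (n + 1)) := ⟨i, by have := i.2; rw [pow_succ]; omega⟩
def hi (n : ℕ) (i : Fin (2 ^ n)) : Fin (2 ^ (n + 1)) := ⟨2 ^ n + i, by have := i.2; rw [pow_succ]; omega⟩

def loHi (n : ℕ) : Fin (2 ^ n) ⊕ Fin (2 ^ n) ≃ Fin (2 ^ (n + 1)) :=
  finSumFinEquiv.trans (finCongr (by rw [pow_succ]; omega))

lemma loHi_inl (n : ℕ) (i : Fin (2 ^ n)) : loHi n (Sum.inl i) = lo n i := by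
  ext; simp [loHi, lo]
lemma loHi_inr (n : ℕ) (i : Fin (2 ^ n)) : loHi n (Sum.inr i) = hi n i := by
  ext; simp [loHi, hi, Nat.add_comm]

lemma sum_loHi {R : Type*} [AddCommMonoid R] (n : ℕ) (f : Fin (2 ^ (n + 1)) → R) :
    ∑ i, f i = ∑ i, f (lo n i) + ∑ i, f (hi n i) := by
  rw [← (loHi n).sum_comp, Fintype.sum_sum_type]
  simp only [loHi_inl, loHi_inr]

abbrev Om (𝒴 : Type*) (n : ℕ) := (Fin (2 ^ n) → Bool) × (Fin (2 ^ n) → 𝒴)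

variable {𝒴 : Type*}

def fstHalf (n : ℕ) (ω : Om 𝒴 (n + 1)) : Om 𝒴 n := (fun i => ω.1 (lo n i), fun i => ω.2 (lo n i))
def sndHalf (n : ℕ) (ω : Om 𝒴 (n + 1)) : Om 𝒴 n := (fun i => ω.1 (hi n i), fun i => ω.2 (hi n i))

def splA (α : Type*) (n : ℕ) : (Fin (2 ^ (n + 1)) → α) ≃ (Fin (2 ^ n) → α) × (Fin (2 ^ n) → α) :=
  (Equiv.arrowCongr (loHi n).symm (Equiv.refl α)).trans (Equiv.sumArrowEquivProdArrow _ _ _)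

def spl (𝒴 : Type*) (n : ℕ) : Om 𝒴 (n + 1) ≃ Om 𝒴 n × Om 𝒴 n :=
  (Equiv.prodCongr (splA Bool n) (splA 𝒴 n)).trans (Equiv.prodProdProdComm _ _ _ _)

lemma spl_apply (n : ℕ) (ω : Om 𝒴 (n + 1)) : spl 𝒴 n ω = (fstHalf n ω, sndHalf n ω) := by
  have h1 : ∀ i, (loHi n) (Sum.inl i) = lo n i := loHi_inl n
  have h2 : ∀ i, (loHi n) (Sum.inr i) = hi n i := loHi_inr n
  ext i <;> simp [spl, splA, fstHalf, sndHalf, Equiv.sumArrowEquivProdArrow, h1, h2, Equiv.arrowCongr]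

/-- the polar bits, indexed by naturals -/
def uN (n : ℕ) (ω : Om 𝒴 n) (i : ℕ) : ZMod 2 := if h : i < 2 ^ n then polarU n ω ⟨i, h⟩ else 0

lemma pm_lo_even (n : ℕ) (i j : Fin (2 ^ n)) (h : 2 * (j:ℕ) < 2 ^ (n + 1)) :
    polarMatrix (n + 1) (lo n i) ⟨2 * j, h⟩ = polarMatrix n i j := by
  unfold polarMatrix
  simp only [Matrix.of_apply]
  rw [Finset.prod_range_succ']
  simp only [lo, bit_even, bit_even0, show n + 1 - 1 - 0 = n by omega, bit_lo i.2]
  rw [show Fmat 0 0 = 1 by decide, mul_one]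
  refine Finset.prod_congr rfl fun k hk => ?_
  rw [show n + 1 - 1 - (k + 1) = n - 1 - k by omega]

lemma pm_hi_even (n : ℕ) (i j : Fin (2 ^ n)) (h : 2 * (j:ℕ) < 2 ^ (n + 1)) :
    polarMatrix (n + 1) (hi n i) ⟨2 * j, h⟩ = polarMatrix n i j := by
  unfold polarMatrix
  simp only [Matrix.of_apply]
  rw [Finset.prod_range_succ']
  simp only [hi, bit_even, bit_even0, show n + 1 - 1 - 0 = n by omega, bit_hi i.2]
  rw [show Fmat 1 0 = 1 by decide, mul_one]
  refine Finset.prod_congr rfl fun k hk => ?_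
  have := Finset.mem_range.1 hk
  rw [show n + 1 - 1 - (k + 1) = n - 1 - k by omega, bit_hi_lt _ (by omega)]

lemma pm_lo_odd (n : ℕ) (i j : Fin (2 ^ n)) (h : 2 * (j:ℕ) + 1 < 2 ^ (n + 1)) :
    polarMatrix (n + 1) (lo n i) ⟨2 * j + 1, h⟩ = 0 := by
  unfold polarMatrix
  simp only [Matrix.of_apply]
  rw [Finset.prod_range_succ']
  simp only [lo, bit_odd, bit_odd0, show n + 1 - 1 - 0 = n by omega, bit_lo i.2]
  rw [show Fmat 0 1 = 0 by decide, mul_zero]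

lemma pm_hi_odd (n : ℕ) (i j : Fin (2 ^ n)) (h : 2 * (j:ℕ) + 1 < 2 ^ (n + 1)) :
    polarMatrix (n + 1) (hi n i) ⟨2 * j + 1, h⟩ = polarMatrix n i j := by
  unfold polarMatrix
  simp only [Matrix.of_apply]
  rw [Finset.prod_range_succ']
  simp only [hi, bit_odd, bit_odd0, show n + 1 - 1 - 0 = n by omega, bit_hi i.2]
  rw [show Fmat 1 1 = 1 by decide, mul_one]
  refine Finset.prod_congr rfl fun k hk => ?_
  have := Finset.mem_range.1 hk
  rw [show n + 1 - 1 - (k + 1) = n - 1 - k by omega, bit_hi_lt _ (by omega)]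

lemma uN_even (n : ℕ) (ω : Om 𝒴 (n + 1)) (j : ℕ) :
    uN (n + 1) ω (2 * j) = uN n (fstHalf n ω) j + uN n (sndHalf n ω) j := by
  have h2 : 2 ^ (n + 1) = 2 * 2 ^ n := pow_succ' 2 n
  unfold uN
  by_cases h : j < 2 ^ n
  · rw [dif_pos (by omega), dif_pos h, dif_pos h]
    simp only [polarU, Matrix.vecMul, dotProduct]
    rw [sum_loHi]
    congr 1 <;> refine Finset.sum_congr rfl fun i _ => ?_
    · rw [pm_lo_even n i ⟨j, h⟩]; rfl
    · rw [pm_hi_even n i ⟨j, h⟩]; rfl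
  · rw [dif_neg (by omega), dif_neg h, dif_neg h, add_zero]

lemma uN_odd (n : ℕ) (ω : Om 𝒴 (n + 1)) (j : ℕ) :
    uN (n + 1) ω (2 * j + 1) = uN n (sndHalf n ω) j := by
  have h2 : 2 ^ (n + 1) = 2 * 2 ^ n := pow_succ' 2 n
  unfold uN
  by_cases h : j < 2 ^ n
  · rw [dif_pos (by omega), dif_pos h]
    simp only [polarU, Matrix.vecMul, dotProduct]
    rw [sum_loHi]
    have : ∀ i, polarMatrix (n + 1) (lo n i) ⟨2 * j + 1, by omega⟩ = 0 := fun i =>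
      pm_lo_odd n i ⟨j, h⟩ _
    simp only [this, mul_zero, Finset.sum_const_zero, zero_add]
    refine Finset.sum_congr rfl fun i _ => ?_
    rw [pm_hi_odd n i ⟨j, h⟩]; rfl
  · rw [dif_neg (by omega), dif_neg h]

lemma half_ext (n : ℕ) {α : Type*} {x y : Fin (2 ^ (n + 1)) → α} :
    x = y ↔ (fun i => x (lo n i)) = (fun i => y (lo n i)) ∧ (fun i => x (hi n i)) = (fun i => y (hi n i)) := by
  constructor
  · rintro rfl; exact ⟨rfl, rfl⟩
  · rintro ⟨h1, h2⟩
    funext k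
    obtain ⟨i, rfl⟩ := (loHi n).surjective k
    rcases i with i | i
    · rw [loHi_inl]; exact congrFun h1 i
    · rw [loHi_inr]; exact congrFun h2 i

lemma uN_inj (n : ℕ) : ∀ ω ω' : Om 𝒴 n, (∀ i, i < 2 ^ n → uN n ω i = uN n ω' i) → ω.1 = ω'.1 := by
  induction n with
  | zero =>
    intro ω ω' h
    have h0 := h 0 (by norm_num)
    have e : ∀ ω : Om 𝒴 0, uN 0 ω 0 = if ω.1 0 then 1 else 0 := by
      intro ω
      have h1 : uN 0 ω 0 = ∑ i : Fin 1, (if ω.1 i then (1 : ZMod 2) else 0) * polarMatrix 0 i 0 := by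
        rfl
      rw [h1, Fin.sum_univ_one]
      simp [polarMatrix]
    rw [e, e] at h0
    funext i
    have : i = 0 := Subsingleton.elim (α := Fin 1) _ _
    rw [this]
    cases h1 : ω.1 0 <;> cases h2 : ω'.1 0 <;> simp [h1, h2] at h0 ⊢
  | succ n ih =>
    intro ω ω' h
    have h2 : 2 ^ (n + 1) = 2 * 2 ^ n := pow_succ' 2 n
    rw [half_ext n]
    have hs : ∀ i, i < 2 ^ n → uN n (sndHalf n ω) i = uN n (sndHalf n ω') i := by
      intro i hi
      rw [← uN_odd, ← uN_odd]; exact h _ (by omega)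
    refine ⟨ih (fstHalf n ω) (fstHalf n ω') fun i hi => ?_, ih (sndHalf n ω) (sndHalf n ω') hs⟩
    have := h (2 * i) (by omega)
    rw [uN_even, uN_even, hs i hi] at this
    exact add_right_cancel this

/-- the observation -/
def Bn (n i : ℕ) (ω : Om 𝒴 n) : (Fin i → ZMod 2) × (Fin (2 ^ n) → 𝒴) := (fun j => uN n ω j, ω.2)

lemma Bn_iff (n i : ℕ) (ω ω' : Om 𝒴 n) :
    Bn n i ω = Bn n i ω' ↔ (∀ j, j < i → uN n ω j = uN n ω' j) ∧ ω.2 = ω'.2 := by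
  unfold Bn
  rw [Prod.mk.injEq]
  refine and_congr ⟨fun h j hj => congrFun h ⟨j, hj⟩, fun h => funext fun j => h j j.2⟩ Iff.rfl

lemma Bn_succ_iff (n i : ℕ) (ω ω' : Om 𝒴 n) :
    (uN n ω i, Bn n i ω) = (uN n ω' i, Bn n i ω') ↔ Bn n (i + 1) ω = Bn n (i + 1) ω' := by
  rw [Prod.mk.injEq, Bn_iff, Bn_iff]
  constructor
  · rintro ⟨h1, h2, h3⟩
    refine ⟨fun j hj => ?_, h3⟩
    rcases Nat.lt_succ_iff_lt_or_eq.1 hj with h | rfl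
    · exact h2 j h
    · exact h1
  · rintro ⟨h1, h2⟩
    exact ⟨h1 i (by omega), fun j hj => h1 j (by omega), h2⟩

lemma Bn_even_iff (n j : ℕ) (ω ω' : Om 𝒴 (n + 1)) :
    Bn (n + 1) (2 * j) ω = Bn (n + 1) (2 * j) ω' ↔
      (Bn n j (fstHalf n ω), Bn n j (sndHalf n ω)) = (Bn n j (fstHalf n ω'), Bn n j (sndHalf n ω')) := by
  rw [Bn_iff, Prod.mk.injEq, Bn_iff, Bn_iff, half_ext n]
  constructor
  · rintro ⟨h1, h2, h3⟩
    have hs : ∀ k, k < j → uN n (sndHalf n ω) k = uN n (sndHalf n ω') k := by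
      intro k hk
      rw [← uN_odd, ← uN_odd]; exact h1 _ (by omega)
    refine ⟨⟨fun k hk => ?_, h2⟩, hs, h3⟩
    have := h1 (2 * k) (by omega)
    rw [uN_even, uN_even, hs k hk] at this
    exact add_right_cancel this
  · rintro ⟨⟨h1, h2⟩, h3, h4⟩
    refine ⟨fun k hk => ?_, h2, h4⟩
    rcases Nat.even_or_odd' k with ⟨m, rfl | rfl⟩
    · rw [uN_even, uN_even, h1 m (by omega), h3 m (by omega)]
    · rw [uN_odd, uN_odd, h3 m (by omega)]

lemma Bn_odd_iff (n j : ℕ) (ω ω' : Om 𝒴 (n + 1)) :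
    Bn (n + 1) (2 * j + 1) ω = Bn (n + 1) (2 * j + 1) ω' ↔
      ((Bn n j (fstHalf n ω), Bn n j (sndHalf n ω)), uN n (fstHalf n ω) j + uN n (sndHalf n ω) j) =
      ((Bn n j (fstHalf n ω'), Bn n j (sndHalf n ω')), uN n (fstHalf n ω') j + uN n (sndHalf n ω') j) := by
  refine (Bn_succ_iff _ _ _ _).symm.trans ?_
  rw [← uN_even, ← uN_even]
  constructor
  · intro h
    exact Prod.ext ((Bn_even_iff n j ω ω').1 (Prod.ext_iff.1 h).2) (Prod.ext_iff.1 h).1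
  · intro h
    exact Prod.ext (Prod.ext_iff.1 h).2 ((Bn_even_iff n j ω ω').2 (Prod.ext_iff.1 h).1)

end polar
end FP

namespace FP

section model
variable {S 𝒴 : Type*} [Fintype S] [DecidableEq S]

/-- one-step transfer matrix -/
noncomputable def Tm (Q : Matrix S S ℝ) (W : S → Bool → 𝒴 → ℝ) (x : Bool) (y : 𝒴) : Matrix S S ℝ :=
  Matrix.of fun s t => 2⁻¹ * W s x y * Q s t

noncomputable def An (Q : Matrix S S ℝ) (W : S → Bool → 𝒴 → ℝ) (n : ℕ) (ω : Om 𝒴 n) : Matrix S S ℝ :=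
  (List.ofFn fun i => Tm Q W (ω.1 i) (ω.2 i)).prod

lemma ofFn_split {α : Type*} {N M : ℕ} (h : N = M + M) (f : Fin N → α) :
    List.ofFn f = List.ofFn (fun i : Fin M => f ⟨i, by omega⟩) ++
      List.ofFn (fun i : Fin M => f ⟨M + i, by omega⟩) := by
  subst h
  rw [List.ofFn_add]
  rfl

lemma An_succ (Q : Matrix S S ℝ) (W : S → Bool → 𝒴 → ℝ) (n : ℕ) (ω : Om 𝒴 (n + 1)) :
    An Q W (n + 1) ω = An Q W n (fstHalf n ω) * An Q W n (sndHalf n ω) := by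
  unfold An
  rw [ofFn_split (show 2 ^ (n + 1) = 2 ^ n + 2 ^ n by rw [pow_succ]; omega), List.prod_append]
  rfl

lemma An_nonneg {Q : Matrix S S ℝ} (hQ0 : ∀ s t, 0 ≤ Q s t) {W : S → Bool → 𝒴 → ℝ}
    (hW0 : ∀ s x y, 0 ≤ W s x y) (n : ℕ) : ∀ (ω : Om 𝒴 n) s t, 0 ≤ An Q W n ω s t := by
  induction n with
  | zero =>
    intro ω s t
    have : An Q W 0 ω = Tm Q W (ω.1 0) (ω.2 0) := by
      unfold An
      have : (List.ofFn fun i : Fin 1 => Tm Q W (ω.1 i) (ω.2 i)).prod = Tm Q W (ω.1 0) (ω.2 0) := by simp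
      exact this
    rw [this]
    unfold Tm
    have := hQ0 s t; have := hW0 s (ω.1 0) (ω.2 0)
    simp only [Matrix.of_apply]; positivity
  | succ n ih =>
    intro ω s t
    rw [An_succ, Matrix.mul_apply]
    exact Finset.sum_nonneg fun r _ => mul_nonneg (ih _ _ _) (ih _ _ _)

lemma An_sum [Fintype 𝒴] (Q : Matrix S S ℝ) (W : S → Bool → 𝒴 → ℝ) (hW1 : ∀ s x, ∑ y, W s x y = 1)
    (n : ℕ) : ∑ ω, An Q W n ω = Q ^ (2 ^ n) := by
  induction n with
  | zero =>
    have : ∀ ω : Om 𝒴 0, An Q W 0 ω = Tm Q W (ω.1 0) (ω.2 0) := by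
      intro ω
      unfold An
      have : (List.ofFn fun i : Fin 1 => Tm Q W (ω.1 i) (ω.2 i)).prod = Tm Q W (ω.1 0) (ω.2 0) := by simp
      exact this
    simp only [this]
    let e : Om 𝒴 0 ≃ Bool × 𝒴 := Equiv.prodCongr (Equiv.funUnique (Fin 1) Bool) (Equiv.funUnique (Fin 1) 𝒴)
    have h := e.sum_comp (fun p => Tm Q W p.1 p.2)
    have h' : ∑ ω : Om 𝒴 0, Tm Q W (ω.1 0) (ω.2 0) = ∑ p : Bool × 𝒴, Tm Q W p.1 p.2 := h
    rw [h', Fintype.sum_prod_type, pow_zero, pow_one]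
    ext s t
    simp only [Matrix.sum_apply, Tm, Matrix.of_apply, ← Finset.sum_mul, ← Finset.mul_sum, hW1]
    simp
    try ring
  | succ n ih =>
    have h := (spl 𝒴 n).sum_comp (fun p => An Q W n p.1 * An Q W n p.2)
    simp only [spl_apply, ← An_succ] at h
    rw [h, Fintype.sum_prod_type, pow_succ, mul_comm, pow_mul', pow_two, ← ih, Finset.sum_mul_sum]

lemma path_sum (Q : Matrix S S ℝ) (m : ℕ) : ∀ (ν : S → ℝ) (w : Fin (m + 1) → S → ℝ)
    (hQ1 : ∀ s, ∑ t, Q s t = 1),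
    ∑ σ : Fin (m + 1) → S, ν (σ 0) *
      (∏ i : Fin (m + 1), if h : (i:ℕ) + 1 < m + 1 then Q (σ i) (σ ⟨(i:ℕ) + 1, h⟩) else 1) *
      ∏ i, w i (σ i) =
    wt ν (List.ofFn fun i => (Matrix.of fun s t => w i s * Q s t : Matrix S S ℝ)).prod := by
  induction m with
  | zero =>
    intro ν w hQ1
    rw [← (Equiv.funUnique (Fin 1) S).symm.sum_comp]
    simp [wt, ← Finset.mul_sum, hQ1]
  | succ m ih =>
    intro ν w hQ1
    rw [← (Fin.consEquiv fun _ : Fin (m + 2) => S).sum_comp, Fintype.sum_prod_type_right]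
    have h2 := ih (fun b => ∑ a, ν a * w 0 a * Q a b) (fun i => w i.succ) hQ1
    rw [List.ofFn_succ, List.prod_cons]
    have h3 : wt ν ((Matrix.of fun s t => w 0 s * Q s t) *
        (List.ofFn fun i : Fin (m + 1) => (Matrix.of fun s t => w i.succ s * Q s t : Matrix S S ℝ)).prod) =
        wt (fun b => ∑ a, ν a * w 0 a * Q a b)
        (List.ofFn fun i : Fin (m + 1) => (Matrix.of fun s t => w i.succ s * Q s t : Matrix S S ℝ)).prod := by
      rw [wt_mul]
      unfold tri wt
      rw [Finset.sum_comm]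
      refine Finset.sum_congr rfl fun b _ => ?_
      rw [Finset.sum_comm]
      refine Finset.sum_congr rfl fun r _ => ?_
      rw [Finset.sum_mul]
      refine Finset.sum_congr rfl fun a _ => ?_
      simp only [Matrix.of_apply]; ring
    rw [h3, ← h2]
    refine Finset.sum_congr rfl fun τ _ => ?_
    rw [Finset.sum_mul, Finset.sum_mul]
    refine Finset.sum_congr rfl fun a _ => ?_
    rw [Fin.prod_univ_succ (n := m + 1), Fin.prod_univ_succ (n := m + 1) (f := fun i => w i _)]
    have e0 : ∀ (h : ((0 : Fin (m + 2)) : ℕ) + 1 < m + 1 + 1),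
        (⟨((0 : Fin (m + 2)) : ℕ) + 1, h⟩ : Fin (m + 2)) = Fin.succ 0 := fun h => rfl
    have e1 : ∀ (i : Fin (m + 1)) (h : ((i.succ : Fin (m + 2)) : ℕ) + 1 < m + 1 + 1),
        (⟨((i.succ : Fin (m + 2)) : ℕ) + 1, h⟩ : Fin (m + 2)) =
          Fin.succ ⟨(i:ℕ) + 1, by simpa using h⟩ := fun i h => rfl
    simp only [Fin.consEquiv_apply, Fin.cons_zero, Fin.cons_succ, e0, e1]
    rw [dif_pos (by simp)]
    simp only [Fin.val_succ, Nat.add_lt_add_iff_right]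
    ring

lemma path_sum' (Q : Matrix S S ℝ) (hQ1 : ∀ s, ∑ t, Q s t = 1) (N : ℕ) (hN : 0 < N) (ν : S → ℝ)
    (w : Fin N → S → ℝ) :
    ∑ σ : Fin N → S, ν (σ ⟨0, hN⟩) *
      (∏ i : Fin N, if h : (i:ℕ) + 1 < N then Q (σ i) (σ ⟨(i:ℕ) + 1, h⟩) else 1) *
      ∏ i, w i (σ i) =
    wt ν (List.ofFn fun i => (Matrix.of fun s t => w i s * Q s t : Matrix S S ℝ)).prod := by
  obtain ⟨m, rfl⟩ := Nat.exists_eq_succ_of_ne_zero hN.ne'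
  exact path_sum Q m ν w hQ1

lemma faim_eq (Q : Matrix S S ℝ) (hQ1 : ∀ s, ∑ t, Q s t = 1) (μ : S → ℝ) (W : S → Bool → 𝒴 → ℝ) (n : ℕ)
    (ω : Om 𝒴 n) : faimLaw Q μ W n ω = wt μ (An Q W n ω) := by
  unfold faimLaw An
  have := path_sum' Q hQ1 (2 ^ n) (Nat.two_pow_pos n) μ (fun i s => 2⁻¹ * W s (ω.1 i) (ω.2 i))
  refine Eq.trans ?_ this
  rw [Finset.mul_sum]
  refine Finset.sum_congr rfl fun σ _ => ?_
  rw [Finset.prod_mul_distrib, Finset.prod_const, Finset.card_univ, Fintype.card_fin, inv_pow]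
  ring

end model
end FP

namespace FP

section rec
variable {S 𝒴 : Type*} [Fintype S] [DecidableEq S] [Fintype 𝒴]

noncomputable def PP (φ : Matrix S S ℝ → Matrix S S ℝ → ℝ) (Q : Matrix S S ℝ) (W : S → Bool → 𝒴 → ℝ)
    (n i : ℕ) : ℝ := Phi φ (An Q W n) (fun ω => uN n ω i) (Bn n i)

noncomputable def F0 (Q : Matrix S S ℝ) (W : S → Bool → 𝒴 → ℝ) (n i : ℕ) (b : ZMod 2)
    (v : (Fin i → ZMod 2) × (Fin (2 ^ n) → 𝒴)) : Matrix S S ℝ :=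
  ff (An Q W n) (fun ω => uN n ω i) (Bn n i) b v

lemma PP_eq (φ : Matrix S S ℝ → Matrix S S ℝ → ℝ) (Q : Matrix S S ℝ) (W : S → Bool → 𝒴 → ℝ) (n i : ℕ) :
    PP φ Q W n i = ∑ v, φ (F0 Q W n i 0 v) (F0 Q W n i 1 v) := rfl

lemma PP_even {φ : Matrix S S ℝ → Matrix S S ℝ → ℝ} (hφ : φ 0 0 = 0) (Q : Matrix S S ℝ)
    (W : S → Bool → 𝒴 → ℝ) (n j : ℕ) :
    PP φ Q W (n + 1) (2 * j) = ∑ v, ∑ v',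
      φ (F0 Q W n j 0 v * F0 Q W n j 0 v' + F0 Q W n j 1 v * F0 Q W n j 1 v')
        (F0 Q W n j 1 v * F0 Q W n j 0 v' + F0 Q W n j 0 v * F0 Q W n j 1 v') := by
  unfold PP F0
  rw [← Phi_minus φ (An Q W n) (fun ω => uN n ω j) (Bn n j), ← Phi_equiv (spl 𝒴 n)]
  rw [Phi_congr hφ _ _ _ (fun ω => (Bn n j (fstHalf n ω), Bn n j (sndHalf n ω))) (Bn_even_iff n j)]
  simp only [spl_apply, An_succ, uN_even]
  congr 1
  funext ω; exact An_succ _ _ _ _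

lemma PP_odd {φ : Matrix S S ℝ → Matrix S S ℝ → ℝ} (hφ : φ 0 0 = 0) (Q : Matrix S S ℝ)
    (W : S → Bool → 𝒴 → ℝ) (n j : ℕ) :
    PP φ Q W (n + 1) (2 * j + 1) = ∑ v, ∑ v',
      (φ (F0 Q W n j 0 v * F0 Q W n j 0 v') (F0 Q W n j 1 v * F0 Q W n j 1 v') +
       φ (F0 Q W n j 1 v * F0 Q W n j 0 v') (F0 Q W n j 0 v * F0 Q W n j 1 v')) := by
  unfold PP F0
  rw [← Phi_plus φ (An Q W n) (fun ω => uN n ω j) (Bn n j), ← Phi_equiv (spl 𝒴 n)]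
  rw [Phi_congr hφ _ _ _ (fun ω => ((Bn n j (fstHalf n ω), Bn n j (sndHalf n ω)),
    uN n (fstHalf n ω) j + uN n (sndHalf n ω) j)) (Bn_odd_iff n j)]
  simp only [spl_apply, An_succ, uN_odd]
  congr 1
  funext ω; exact An_succ _ _ _ _

lemma good {Q : Matrix S S ℝ} (hQ0 : ∀ s t, 0 ≤ Q s t) (hQ1 : ∀ s, ∑ t, Q s t = 1)
    {μ : S → ℝ} (hμ : ∀ s, 0 < μ s) (hμ1 : ∑ s, μ s = 1)
    (hstat : ∀ t, ∑ s, μ s * Q s t = μ t)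
    {W : S → Bool → 𝒴 → ℝ} (hW0 : ∀ s x y, 0 ≤ W s x y) (hW1 : ∀ s x, ∑ y, W s x y = 1)
    {c : ℝ} (hc : ∀ s, 1 ≤ c * μ s) (n i : ℕ) :
    Good μ c (Q ^ (2 ^ n)) (F0 Q W n i 0) (F0 Q W n i 1) where
  n0 := ff_nonneg (An_nonneg hQ0 hW0 n) _ _ _
  n1 := ff_nonneg (An_nonneg hQ0 hW0 n) _ _ _
  sm := by
    unfold F0
    simp only [ff_add]
    rw [sum_gg, An_sum Q W hW1]
  row := pow_row hQ1 _
  stat := pow_stat hstat _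
  pos := hμ
  one := hμ1
  hc := hc

lemma PP_sum {φ : Matrix S S ℝ → Matrix S S ℝ → ℝ} {ψ : Matrix S S ℝ → ℝ} (hψ : ψ 0 = 0)
    (h : ∀ a b, φ a b = ψ a + ψ b - ψ (a + b)) (Q : Matrix S S ℝ) (W : S → Bool → 𝒴 → ℝ) (n : ℕ) :
    ∑ i ∈ Finset.range (2 ^ n), PP φ Q W n i =
      Psi ψ (An Q W n) (fun ω => ω) - Psi ψ (An Q W n) (fun ω => ω.2) := by
  have h1 : ∀ i, PP φ Q W n i = Psi ψ (An Q W n) (Bn n (i + 1)) - Psi ψ (An Q W n) (Bn n i) := by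
    intro i
    unfold PP
    rw [chain φ ψ h, Psi_congr hψ _ _ (Bn n (i + 1)) (Bn_succ_iff n i)]
  simp only [h1]
  rw [Finset.sum_range_sub (fun i => Psi ψ (An Q W n) (Bn n i))]
  congr 1
  · refine Psi_congr hψ _ _ _ fun ω ω' => ?_
    rw [Bn_iff]
    constructor
    · rintro ⟨h1, h2⟩; exact Prod.ext (uN_inj n ω ω' h1) h2
    · rintro rfl; simp
  · refine Psi_congr hψ _ _ _ fun ω ω' => ?_
    rw [Bn_iff]; simp

lemma psH_zero (μ : S → ℝ) : psH μ (0 : Matrix S S ℝ) = 0 := by simp [psH, wt_zero]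
lemma psE_zero (μ : S → ℝ) : psE μ (0 : Matrix S S ℝ) = 0 := by simp [psE]

lemma prb_eq {V : Type*} [Fintype V] [DecidableEq V] {Q : Matrix S S ℝ} (hQ1 : ∀ s, ∑ t, Q s t = 1)
    (μ : S → ℝ) (W : S → Bool → 𝒴 → ℝ) (n : ℕ) (B : Om 𝒴 n → V) (v : V) :
    prb (faimLaw Q μ W n) B v = wt μ (gg (An Q W n) B v) := by
  unfold prb gg
  rw [wt_sum]
  refine Finset.sum_congr rfl fun ω _ => ?_
  rw [faim_eq Q hQ1]
  split_ifs
  · rfl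
  · rw [wt_zero]

lemma bhatta_eq [DecidableEq 𝒴] {Q : Matrix S S ℝ} (hQ1 : ∀ s, ∑ t, Q s t = 1)
    (μ : S → ℝ) (W : S → Bool → 𝒴 → ℝ) (n : ℕ) (i : Fin (2 ^ n)) :
    bhatta (faimLaw Q μ W n) (fun ω => polarU n ω i)
      (fun ω => ((fun j : Fin (i : ℕ) => polarU n ω (Fin.castLE i.isLt.le j)), ω.2)) =
    PP (fZ μ) Q W n i := by
  have hB : (fun ω : Om 𝒴 n => ((fun j : Fin (i : ℕ) => polarU n ω (Fin.castLE i.isLt.le j)), ω.2)) =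
      Bn n i := by
    funext ω
    refine Prod.ext (funext fun j => ?_) rfl
    simp only [Bn, uN]
    rw [dif_pos (j.2.trans i.2)]
    rfl
  have hu : (fun ω : Om 𝒴 n => polarU n ω i) = fun ω => uN n ω i := by
    funext ω
    simp only [uN]
    rw [dif_pos i.2]
  rw [hB, hu]
  unfold bhatta PP Phi
  rw [Finset.mul_sum]
  refine Finset.sum_congr rfl fun v _ => ?_
  unfold fZ
  rw [prb_eq hQ1, prb_eq hQ1, gg_pair, gg_pair]

lemma cond_aux {ι : Type*} [Fintype ι] (p : ι → ℝ) (hp : ∀ i, 0 ≤ p i) :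
    -(Real.log 2 * ∑ i, p i * Real.logb 2 (p i / ∑ j, p j)) =
      ∑ i, Real.negMulLog (p i) - Real.negMulLog (∑ i, p i) := by
  have hl2 : Real.log 2 ≠ 0 := (Real.log_pos (by norm_num)).ne'
  set P := ∑ j, p j with hP
  have h1 : Real.negMulLog P = ∑ i, -(p i * Real.log P) := by
    rw [Real.negMulLog, Finset.sum_neg_distrib, ← Finset.sum_mul, ← hP]; ring
  rw [h1, ← Finset.sum_sub_distrib, Finset.mul_sum, ← Finset.sum_neg_distrib]
  refine Finset.sum_congr rfl fun i _ => ?_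
  rcases (hp i).eq_or_lt with h | h
  · simp [← h]
  · have h2 : p i ≤ P := Finset.single_le_sum (fun i _ => hp i) (Finset.mem_univ i)
    rw [Real.logb, Real.log_div h.ne' (h.trans_le h2).ne', Real.negMulLog]
    field_simp
    ring

lemma condEnt_eq [DecidableEq 𝒴] {Q : Matrix S S ℝ} (hQ0 : ∀ s t, 0 ≤ Q s t)
    (hQ1 : ∀ s, ∑ t, Q s t = 1)
    {μ : S → ℝ} (hμ : ∀ s, 0 < μ s) {W : S → Bool → 𝒴 → ℝ} (hW0 : ∀ s x y, 0 ≤ W s x y) (n : ℕ) :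
    Real.log 2 * condEnt (faimLaw Q μ W n) Prod.fst Prod.snd =
      Psi (psH μ) (An Q W n) (fun ω => ω) - Psi (psH μ) (An Q W n) (fun ω => ω.2) := by
  have hl2 : Real.log 2 ≠ 0 := (Real.log_pos (by norm_num)).ne'
  unfold condEnt Psi psH
  have hp : ∀ a b, prb (faimLaw Q μ W n) (fun ω => (Prod.fst ω, Prod.snd ω)) (a, b) =
      faimLaw Q μ W n (a, b) := by
    intro a b
    unfold prb
    simp
  have hg : ∀ ω, wt μ (gg (An Q W n) (fun ω => ω) ω) = faimLaw Q μ W n ω := by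
    intro ω
    rw [← prb_eq hQ1 μ W n (fun ω => ω) ω]
    unfold prb; simp
  have hn : ∀ ω, 0 ≤ faimLaw Q μ W n ω := by
    intro ω
    rw [faim_eq Q hQ1]
    exact wt_nonneg hμ (An_nonneg hQ0 hW0 n ω)
  have hs : ∀ b, prb (faimLaw Q μ W n) Prod.snd b = ∑ a, faimLaw Q μ W n (a, b) := by
    intro b
    unfold prb
    rw [Fintype.sum_prod_type]
    simp
  simp only [hp, hg]
  simp only [← prb_eq hQ1 μ W n (fun ω => ω.2)]
  have hs' : ∀ b, prb (faimLaw Q μ W n) (fun ω => ω.2) b = ∑ a, faimLaw Q μ W n (a, b) := hs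
  simp only [hs, hs']
  rw [Fintype.sum_prod_type_right, Finset.sum_comm,
    ← Finset.sum_sub_distrib, mul_neg, Finset.mul_sum, ← Finset.sum_neg_distrib]
  refine Finset.sum_congr rfl fun b _ => ?_
  exact cond_aux (fun a => faimLaw Q μ W n (a, b)) fun a => hn _

end rec
end FP

/-- **Fast polarization for FAIM channels**: for a finite-state, aperiodic,
irreducible hidden-Markov (FAIM) classical channel with conditional entropy rate
`𝓗_{X|Y}`, for every `β < 1/2` the fraction of synthesized channels with
Bhattacharyya parameter `Z(Uᵢ | U_{<i}, Y₁^N) < 2^{-N^β}` tends to `1 - 𝓗_{X|Y}`. -/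
theorem faim_fast_polarization
    {S 𝒴 : Type*} [Fintype S] [Nonempty S] [DecidableEq S]
    [Fintype 𝒴] [Nonempty 𝒴] [DecidableEq 𝒴]
    (Q : Matrix S S ℝ) (hQ0 : ∀ s t, 0 ≤ Q s t) (hQ1 : ∀ s, ∑ t, Q s t = 1)
    -- irreducibility
    (hirr : ∀ s t, ∃ k, 1 ≤ k ∧ 0 < (Q ^ k) s t)
    -- aperiodicity: at every state the gcd of return times is 1
    (haper : ∀ s : S, ∀ d : ℕ, (∀ k, 1 ≤ k → 0 < (Q ^ k) s s → d ∣ k) → d = 1)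
    (μ : S → ℝ) (hμ0 : ∀ s, 0 ≤ μ s) (hμ1 : ∑ s, μ s = 1)
    (hstat : ∀ t, ∑ s, μ s * Q s t = μ t)
    (W : S → Bool → 𝒴 → ℝ) (hW0 : ∀ s x y, 0 ≤ W s x y) (hW1 : ∀ s x, ∑ y, W s x y = 1)
    -- the conditional entropy rate `𝓗_{X|Y}` (this limit exists)
    (HXY : ℝ)
    (hH : Tendsto (fun n : ℕ =>
        condEnt (faimLaw Q μ W n) Prod.fst Prod.snd / (2 ^ n : ℝ)) atTop (𝓝 HXY))
    (β : ℝ) (hβ : β < 1 / 2) :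
    Tendsto (fun n : ℕ =>
      ((Finset.univ.filter fun i : Fin (2 ^ n) =>
          bhatta (faimLaw Q μ W n) (fun ω => polarU n ω i)
            (fun ω => ((fun j : Fin (i : ℕ) => polarU n ω (Fin.castLE i.isLt.le j)), ω.2))
          < (2 : ℝ) ^ (-(((2 ^ n : ℕ) : ℝ) ^ β))).card : ℝ) / (2 ^ n : ℝ))
      atTop (𝓝 (1 - HXY)) := by
  classical
  have hμ : ∀ s, 0 < μ s := FP.mu_pos hQ0 hirr hμ0 hμ1 hstat
  obtain ⟨w, hw, k0, hk0⟩ := FP.exists_w hQ0 hQ1 hirr haper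
  obtain ⟨c, hc1, hc⟩ : ∃ c : ℝ, 1 ≤ c ∧ ∀ s, 1 ≤ c * μ s := by
    refine ⟨1 + ∑ s, (μ s)⁻¹, ?_, fun s => ?_⟩
    · linarith [Finset.sum_nonneg (s := Finset.univ) fun s _ => (inv_pos.2 (hμ s)).le]
    · have h1 : (μ s)⁻¹ ≤ ∑ s, (μ s)⁻¹ :=
        Finset.single_le_sum (fun s _ => (inv_pos.2 (hμ s)).le) (Finset.mem_univ s)
      have h2 : (μ s)⁻¹ * μ s = 1 := inv_mul_cancel₀ (hμ s).ne'
      nlinarith [hμ s]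
  have G := fun n i => FP.good hQ0 hQ1 hμ hμ1 hstat hW0 hW1 hc n i
  have hl2 : 0 < Real.log 2 := Real.log_pos (by norm_num)
  have main := FP.assembly (FP.PP (FP.fE μ) Q W) (FP.PP (FP.fH μ) Q W) (FP.PP (FP.fZ μ) Q W)
    (FP.PP (FP.fK μ) Q W) (2 * c + 3) (by linarith) (Fintype.card (S × S)) HXY
    (fun n j _ => (G n j).E_nonneg)
    (fun n j _ => by
      rw [FP.PP_even (FP.fE_zero μ), FP.PP_odd (FP.fE_zero μ)]
      exact (G n j).E_pm)
    (by
      intro ε hε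
      have hcard : (0:ℝ) < Fintype.card S := by exact_mod_cast Fintype.card_pos
      obtain ⟨δ, hδ, hδw, hδε⟩ : ∃ δ : ℝ, 0 < δ ∧ 2 * δ < w ∧ Fintype.card S * δ ≤ ε ^ 2 := by
        refine ⟨min (w / 4) (ε ^ 2 / Fintype.card S), by positivity, ?_, ?_⟩
        · linarith [min_le_left (w / 4) (ε ^ 2 / Fintype.card S)]
        · calc _ ≤ (Fintype.card S : ℝ) * (ε ^ 2 / Fintype.card S) := by
                gcongr; exact min_le_right _ _
            _ = _ := by field_simp
      refine ⟨δ ^ 2 / (2 * c), by positivity, ?_⟩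
      filter_upwards [eventually_ge_atTop k0] with n hn j _ hE
      rw [FP.PP_even (FP.fE_zero μ)] at hE
      have h1 := (G n j).E_minus
      rw [← FP.PP_eq] at h1
      have hd := (G n j).dichotomy (hk0 (2 ^ n) (hn.trans Nat.lt_two_pow_self.le)) hδ hδw (by
        have h2 := h1.trans (sub_le_iff_le_add.1 hE)
        have h3 := fun x : ℝ => show (1 / 2) * x ≤ δ ^ 2 / (2 * c) → c * x ≤ δ ^ 2 from fun h => by
          rw [le_div_iff₀ (by linarith)] at h
          linarith
        apply h3
        linarith)
      rcases hd with h | h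
      · left
        exact abs_le_of_sq_le_sq' (((G n j).K_sq.trans h).trans hδε) hε.le |>.2
      · right
        exact abs_le_of_sq_le_sq' (((G n j).E_le_one_sub.trans h).trans hδε) hε.le |>.2)
    (fun n j _ => (G n j).E_le_H) (fun n j _ => (G n j).H_le)
    (fun n j => FP.Good.Z_nonneg) (fun n j => (G n j).K_nonneg)
    (fun n j _ => (G n j).H_le_Z) (fun n j _ => (G n j).Z_sq)
    (fun n j _ => (G n j).log_sub_H_le_K) (fun n j _ => (G n j).one_sub_K_le_Z)
    (by
      intro n
      rw [Finset.sum_sub_distrib, FP.PP_sum (FP.psH_zero μ) (FP.fH_ps μ),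
        FP.PP_sum (FP.psE_zero μ) (FP.fE_ps μ)]
      have h1 := FP.Psi_H_le_E hμ (FP.An_nonneg hQ0 hW0 n) (fun ω => ω)
      have h2 := FP.Psi_E_le hμ (FP.An_nonneg hQ0 hW0 n)
        (by rw [FP.An_sum Q W hW1]; exact (G n 0).wt_q) (fun ω => ω.2)
      linarith)
    (by
      have := hH.const_mul (Real.log 2)
      refine this.congr fun n => ?_
      unfold FP.avg
      rw [FP.PP_sum (FP.psH_zero μ) (FP.fH_ps μ), ← FP.condEnt_eq hQ0 hQ1 hμ hW0, mul_div_assoc])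
    (fun n j _ => by
      have h0 : 0 ≤ FP.PP (FP.fZ μ) Q W n j := FP.Good.Z_nonneg
      rw [FP.PP_even (FP.fZ_zero μ), FP.PP_odd (FP.fZ_zero μ)]
      refine ⟨(G n j).Z_minus.trans ?_, (G n j).Z_plus.trans ?_⟩
      · rw [← FP.PP_eq]; nlinarith
      · rw [← FP.PP_eq]; nlinarith [sq_nonneg (FP.PP (FP.fZ μ) Q W n j)])
    (fun n j _ => by
      have h0 : 0 ≤ FP.PP (FP.fK μ) Q W n j := (G n j).K_nonneg
      rw [FP.PP_even (FP.fK_zero μ), FP.PP_odd (FP.fK_zero μ)]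
      refine ⟨(G n j).K_plus.trans ?_, (G n j).K_minus.trans ?_⟩
      · rw [← FP.PP_eq]; nlinarith
      · rw [← FP.PP_eq]; nlinarith [sq_nonneg (FP.PP (FP.fK μ) Q W n j)])
    β hβ
  refine main.congr fun n => ?_
  unfold FP.frac
  congr 2
  simp only [FP.bhatta_eq hQ1]
  rw [Finset.card_filter, Finset.card_filter, Finset.sum_range]
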